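/- arXiv:math/0606056 — 7 statements merged into one kernel-verified Lean document; each statement's English description precedes it below -/
import Mathlib

section
/- Let e_n denote the number of n×n linear derangements over 𝔽_q, with e_0 = 1. Then for all n ≥ 1, the recursion e_n = e_{n−1}·(q^n − 1)·q^{n−1} + (−1)^n · q^{n(n−1)/2} holds (as an identity of integers). -/
/-- The number of `n × n` linear derangements over the field `F`, i.e. matrices `A`
such that both `A` and `A - 1` are invertible. -/
noncomputable def linDerCount (F : Type) [Field F] [Fintype F] (n : ℕ) : ℕ :=
  Nat.card {A : Matrix (Fin n) (Fin n) F // IsUnit A ∧ IsUnit (A - 1)}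

open Module Finset

section Counting

variable {F V : Type*} [Field F] [AddCommGroup V] [Module F V]

/-- The linearly independent `m`-tuples of vectors, as an invariant subset for the action of the
linear automorphisms. -/
def linIndepTuples (F V : Type*) [Field F] [AddCommGroup V] [Module F V] (m : ℕ) :
    SubMulAction (V ≃ₗ[F] V) (Fin m → V) where
  carrier := {s | LinearIndependent F s}
  smul_mem' g _ hs := hs.map' (g : V →ₗ[F] V) g.ker

/-- Any two linearly independent `m`-tuples are related by a linear automorphism. -/
theorem isPretransitive_linIndepTuples (m : ℕ) :
    MulAction.IsPretransitive (V ≃ₗ[F] V) (linIndepTuples F V m) where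
  exists_smul_eq := by
    rintro ⟨s, hs⟩ ⟨t, ht⟩
    have hs' : LinearIndependent F s := hs
    have ht' : LinearIndependent F t := ht
    let b := Basis.span hs'
    let c := Basis.span ht'
    have : FiniteDimensional F (Submodule.span F (Set.range s)) := Module.Finite.of_basis b
    obtain ⟨g, hg⟩ := Submodule.exists_linearEquiv_restrict_eq (b.equiv c (Equiv.refl _))
    refine ⟨g, Subtype.ext <| funext fun i ↦ ?_⟩
    have h := hg (b i)
    rw [Basis.equiv_apply] at h
    simp only [Equiv.refl_apply, b, c, Basis.span_apply] at h
    exact h.symm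

/-- The number of linearly independent `m`-tuples, with no restriction on `m`. -/
theorem natCast_card_linearIndependent [Fintype F] [FiniteDimensional F V] (m : ℕ) :
    (Nat.card {s : Fin m → V // LinearIndependent F s} : ℚ) =
      ∏ i ∈ range m, ((Fintype.card F : ℚ) ^ finrank F V - (Fintype.card F : ℚ) ^ i) := by
  have : Finite V := Module.finite_of_finite F
  by_cases hm : m ≤ finrank F V
  · rw [card_linearIndependent hm, Finset.prod_range, Nat.cast_prod]
    refine Finset.prod_congr rfl fun i _ ↦ ?_
    rw [Nat.cast_sub (Nat.pow_le_pow_right Fintype.card_pos (i.2.le.trans hm))]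
    push_cast
    rfl
  · rw [Finset.prod_eq_zero (i := finrank F V) (by simpa using hm) (sub_self _)]
    have : IsEmpty {s : Fin m → V // LinearIndependent F s} :=
      ⟨fun s ↦ hm (by simpa using s.2.fintype_card_le_finrank)⟩
    simp

/-- The fixed vectors of a linear automorphism. -/
abbrev fixedSubspace (g : V ≃ₗ[F] V) : Submodule F V :=
  LinearMap.ker ((g : V →ₗ[F] V) - 1)

theorem mem_fixedSubspace {g : V ≃ₗ[F] V} {v : V} : v ∈ fixedSubspace g ↔ g v = v := by
  simp [fixedSubspace, sub_eq_zero]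

/-- The fixed tuples of `g` are the linearly independent tuples in the fixed subspace of `g`. -/
def fixedByLinIndepTuplesEquiv (g : V ≃ₗ[F] V) (m : ℕ) :
    MulAction.fixedBy (linIndepTuples F V m) g ≃
      {s : Fin m → fixedSubspace g // LinearIndependent F s} where
  toFun s := ⟨fun i ↦ ⟨s.1.1 i, mem_fixedSubspace.2 (congrFun (congrArg Subtype.val s.2) i)⟩,
    LinearIndependent.of_comp (fixedSubspace g).subtype s.1.2⟩
  invFun s := ⟨⟨fun i ↦ s.1 i, s.2.map' _ (fixedSubspace g).ker_subtype⟩,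
    Subtype.ext <| funext fun i ↦ mem_fixedSubspace.1 (s.1 i).2⟩
  left_inv _ := rfl
  right_inv _ := rfl

/-- Burnside's lemma for the action on linearly independent `m`-tuples. -/
theorem sum_prod_fixedSubspace [Fintype F] [FiniteDimensional F V] [Fintype (V ≃ₗ[F] V)]
    {m : ℕ} (hm : m ≤ finrank F V) :
    ∑ g : V ≃ₗ[F] V, ∏ i ∈ range m,
      ((Fintype.card F : ℚ) ^ finrank F (fixedSubspace g) - (Fintype.card F : ℚ) ^ i) =
      Nat.card (V ≃ₗ[F] V) := by
  classical
  have : Finite V := Module.finite_of_finite F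
  have := Fintype.ofFinite V
  have hpre := isPretransitive_linIndepTuples (F := F) (V := V) m
  have hne : Nonempty (linIndepTuples F V m) := by
    let b := finBasis F V
    exact ⟨⟨b ∘ Fin.castLE hm, b.linearIndependent.comp _ (Fin.castLE_injective hm)⟩⟩
  let Ω := MulAction.orbitRel.Quotient (V ≃ₗ[F] V) (linIndepTuples F V m)
  have hsub : Subsingleton Ω :=
    (MulAction.pretransitive_iff_subsingleton_quotient _ _).1 hpre
  have := Fintype.ofFinite Ω
  have : ∀ g : V ≃ₗ[F] V, Fintype (MulAction.fixedBy (linIndepTuples F V m) g) :=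
    fun g ↦ Fintype.ofFinite _
  have hΩ : Fintype.card Ω = 1 :=
    Fintype.card_eq_one_iff_nonempty_unique.2
      ⟨⟨⟨Quotient.mk'' hne.some⟩, fun _ ↦ Subsingleton.elim _ _⟩⟩
  have key := MulAction.sum_card_fixedBy_eq_card_orbits_mul_card_group
    (V ≃ₗ[F] V) (linIndepTuples F V m)
  rw [hΩ, one_mul] at key
  rw [Nat.card_eq_fintype_card, ← key, Nat.cast_sum]
  refine Finset.sum_congr rfl fun g _ ↦ ?_
  rw [← Nat.card_eq_fintype_card (α := MulAction.fixedBy _ g),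
    Nat.card_congr (fixedByLinIndepTuplesEquiv g m),
    natCast_card_linearIndependent]

end Counting

section QIdentity

/-- The order of `GL_m` over a field with `q` elements, as a rational number. -/
def orderGL (q : ℚ) (m : ℕ) : ℚ := ∏ i ∈ range m, (q ^ m - q ^ i)

theorem prod_range_succ_mul_sub (q x : ℚ) (m : ℕ) :
    ∏ i ∈ range (m + 1), (q * x - q ^ i) = (q * x - 1) * q ^ m * ∏ i ∈ range m, (x - q ^ i) := by
  rw [Finset.prod_range_succ']
  have : ∀ i ∈ range m, q * x - q ^ (i + 1) = q * (x - q ^ i) := fun _ _ ↦ by ring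
  rw [Finset.prod_congr rfl this, Finset.prod_mul_distrib]
  simp
  ring

theorem orderGL_succ (q : ℚ) (m : ℕ) :
    orderGL q (m + 1) = (q ^ (m + 1) - 1) * q ^ m * orderGL q m := by
  have := prod_range_succ_mul_sub q (q ^ m) m
  rwa [← pow_succ'] at this

theorem orderGL_ne_zero {q : ℚ} (hq : 1 < q) (m : ℕ) : orderGL q m ≠ 0 :=
  Finset.prod_ne_zero_iff.2 fun _ hi ↦
    (sub_pos.2 (pow_lt_pow_right₀ hq (Finset.mem_range.1 hi))).ne'

/-- The coefficients of the inversion formula. -/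
def invCoeff (q : ℚ) (m : ℕ) : ℚ := (-1) ^ m * q ^ (m.choose 2) / orderGL q m

theorem sum_invCoeff_mul_prod {q : ℚ} (hq : 1 < q) (x : ℚ) (n : ℕ) :
    ∑ m ∈ range (n + 1), invCoeff q m * ∏ i ∈ range m, (q * x - q ^ i) =
      invCoeff q n * q ^ n * ∏ i ∈ range n, (x - q ^ i) := by
  induction n with
  | zero => simp
  | succ n ih =>
    rw [Finset.sum_range_succ, ih, prod_range_succ_mul_sub, Finset.prod_range_succ (n := n)]
    have h0 := orderGL_ne_zero hq n
    have h1 := orderGL_ne_zero hq (n + 1)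
    have h2 : (n + 1).choose 2 = n.choose 2 + n := by
      rw [Nat.choose_succ_succ' n 1, Nat.choose_one_right, add_comm]
    have h3 : invCoeff q n = -invCoeff q (n + 1) * (q ^ (n + 1) - 1) := by
      rw [orderGL_succ] at h1
      have := left_ne_zero_of_mul h1
      have h4 := left_ne_zero_of_mul this
      have h5 := right_ne_zero_of_mul this
      rw [invCoeff, invCoeff, orderGL_succ, h2]
      field_simp
      ring
    rw [h3]
    ring

theorem sum_invCoeff_mul_prod_pow {q : ℚ} (hq : 1 < q) {d n : ℕ} (hd : d ≤ n) :
    ∑ m ∈ range (n + 1), invCoeff q m * ∏ i ∈ range m, (q ^ d - q ^ i) =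
      if d = 0 then 1 else 0 := by
  cases d with
  | zero =>
    rw [Finset.sum_range_succ', Finset.sum_eq_zero]
    · simp [invCoeff, orderGL]
    · intro m _
      rw [Finset.prod_eq_zero (i := 0) (by simp) (sub_self _), mul_zero]
  | succ d =>
    rw [pow_succ', sum_invCoeff_mul_prod hq,
      Finset.prod_eq_zero (i := d) (Finset.mem_range.2 hd) (sub_self _)]
    simp

end QIdentity

section Derangements

variable {F V : Type*} [Field F] [AddCommGroup V] [Module F V]

theorem card_linearEquiv_fixedSubspace_eq_bot [Fintype F] [FiniteDimensional F V] :
    (Nat.card {g : V ≃ₗ[F] V // fixedSubspace g = ⊥} : ℚ) =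
      Nat.card (V ≃ₗ[F] V) * ∑ m ∈ range (finrank F V + 1), invCoeff (Fintype.card F) m := by
  classical
  have : Finite V := Module.finite_of_finite F
  have : Finite (V ≃ₗ[F] V) := Finite.of_injective _ DFunLike.coe_injective
  have := Fintype.ofFinite (V ≃ₗ[F] V)
  have hq : (1 : ℚ) < Fintype.card F := by exact_mod_cast Fintype.one_lt_card
  calc (Nat.card {g : V ≃ₗ[F] V // fixedSubspace g = ⊥} : ℚ)
      = ∑ g : V ≃ₗ[F] V, if finrank F (fixedSubspace g) = 0 then 1 else 0 := by
        rw [Nat.card_eq_fintype_card, Fintype.card_subtype]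
        simp [Submodule.finrank_eq_zero]
    _ = ∑ g : V ≃ₗ[F] V, ∑ m ∈ range (finrank F V + 1), invCoeff (Fintype.card F) m *
          ∏ i ∈ range m,
            ((Fintype.card F : ℚ) ^ finrank F (fixedSubspace g) - (Fintype.card F : ℚ) ^ i) :=
        Finset.sum_congr rfl fun g _ ↦
          (sum_invCoeff_mul_prod_pow hq (Submodule.finrank_le _)).symm
    _ = _ := by
        rw [Finset.sum_comm, Finset.mul_sum]
        refine Finset.sum_congr rfl fun m hm ↦ ?_
        rw [← Finset.mul_sum, sum_prod_fixedSubspace (Nat.lt_succ_iff.1 (Finset.mem_range.1 hm)),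
          mul_comm]

/-- Invertible matrices as linear automorphisms. -/
noncomputable def glEquivLinearEquiv (F : Type*) [Field F] (n : ℕ) :
    GL (Fin n) F ≃ ((Fin n → F) ≃ₗ[F] (Fin n → F)) :=
  (Matrix.GeneralLinearGroup.toLin.trans
    (LinearMap.GeneralLinearGroup.generalLinearEquiv F (Fin n → F))).toEquiv

theorem coe_glEquivLinearEquiv {n : ℕ} (A : GL (Fin n) F) :
    (glEquivLinearEquiv F n A : (Fin n → F) →ₗ[F] (Fin n → F)) = Matrix.toLin' A.1 :=
  rfl

theorem isUnit_sub_one_iff_fixedSubspace {n : ℕ} (A : GL (Fin n) F) :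
    IsUnit (A.1 - 1) ↔ fixedSubspace (glEquivLinearEquiv F n A) = ⊥ := by
  have h : (glEquivLinearEquiv F n A : (Fin n → F) →ₗ[F] (Fin n → F)) - 1 =
      Matrix.toLinAlgEquiv' (A.1 - 1) := by
    rw [map_sub, map_one, coe_glEquivLinearEquiv]
    rfl
  rw [fixedSubspace, h, ← LinearMap.isUnit_iff_ker_eq_bot, MulEquiv.isUnit_map]

/-- Linear derangements are the linear automorphisms without nonzero fixed vectors. -/
noncomputable def derangementEquiv (F : Type*) [Field F] (n : ℕ) :
    {A : Matrix (Fin n) (Fin n) F // IsUnit A ∧ IsUnit (A - 1)} ≃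
      {g : (Fin n → F) ≃ₗ[F] (Fin n → F) // fixedSubspace g = ⊥} :=
  Equiv.trans
    { toFun := fun A ↦ (⟨A.2.1.unit, A.2.2⟩ : {A : GL (Fin n) F // IsUnit (A.1 - 1)})
      invFun := fun A ↦ ⟨A.1.1, A.1.isUnit, A.2⟩
      left_inv := fun _ ↦ rfl
      right_inv := fun _ ↦ Subtype.ext (Units.ext rfl) }
    ((glEquivLinearEquiv F n).subtypeEquiv isUnit_sub_one_iff_fixedSubspace)

theorem natCast_card_GL [Fintype F] (n : ℕ) :
    (Nat.card (GL (Fin n) F) : ℚ) = orderGL (Fintype.card F) n := by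
  rw [Nat.card_congr (Matrix.equiv_GL_linearindependent n), natCast_card_linearIndependent,
    Module.finrank_fin_fun, orderGL]

end Derangements

theorem linDerCount_eq (F : Type) [Field F] [Fintype F] (n : ℕ) :
    (linDerCount F n : ℚ) =
      orderGL (Fintype.card F) n * ∑ m ∈ range (n + 1), invCoeff (Fintype.card F) m := by
  rw [linDerCount, Nat.card_congr (derangementEquiv F n), card_linearEquiv_fixedSubspace_eq_bot,
    ← Nat.card_congr (glEquivLinearEquiv F n), natCast_card_GL, Module.finrank_fin_fun]

theorem linDerCount_recursion {F : Type} [Field F] [Fintype F] (q : ℕ)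
    (hq : Fintype.card F = q) (n : ℕ) (hn : 1 ≤ n) :
    (linDerCount F n : ℤ) =
      (linDerCount F (n - 1) : ℤ) * ((q : ℤ) ^ n - 1) * (q : ℤ) ^ (n - 1)
        + (-1) ^ n * (q : ℤ) ^ (n * (n - 1) / 2) := by
  obtain ⟨k, rfl⟩ := Nat.exists_eq_add_of_le' hn
  have h1 : (1 : ℚ) < q := by
    rw [← hq]
    exact_mod_cast Fintype.one_lt_card
  have h : (linDerCount F (k + 1) : ℚ) = linDerCount F k * ((q : ℚ) ^ (k + 1) - 1) * (q : ℚ) ^ k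
      + (-1) ^ (k + 1) * (q : ℚ) ^ ((k + 1).choose 2) := by
    rw [linDerCount_eq, linDerCount_eq, hq, Finset.sum_range_succ _ (k + 1), mul_add,
      invCoeff, mul_div_cancel₀ _ (orderGL_ne_zero h1 _), orderGL_succ]
    ring
  rw [Nat.choose_two_right] at h
  rw [Nat.add_sub_cancel] at h ⊢
  exact_mod_cast h
end

section
/- Let e_n denote the number of n×n linear derangements over 𝔽_q, with e_0 = 1, and set a_n = e_n / q^{n(n−1)/2}. Then a_0 = 1 and for all n ≥ 1, a_n = a_{n−1}·(q^n − 1) + (−1)^n (in particular each a_n is an integer and q^{n(n−1)/2} divides e_n). -/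
open Finset Module

/-- The action of linear automorphisms on linearly independent families. -/
@[reducible]
def linearIndependentMulAction (K V ι : Type*) [Field K] [AddCommGroup V] [Module K V] :
    MulAction (V ≃ₗ[K] V) {s : ι → V // LinearIndependent K s} where
  smul g s := ⟨g ∘ s.1, s.2.map' g.toLinearMap g.ker⟩
  one_smul _ := rfl
  mul_smul _ _ _ := rfl

section Burnside

variable {K V : Type*} [Field K] [AddCommGroup V] [Module K V]

theorem LinearIndependent.exists_linearEquiv_comp_eq {ι : Type*} [Finite ι] {s t : ι → V}
    (hs : LinearIndependent K s) (ht : LinearIndependent K t) :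
    ∃ g : V ≃ₗ[K] V, g ∘ s = t := by
  have : FiniteDimensional K (Submodule.span K (Set.range s)) :=
    FiniteDimensional.span_of_finite K (Set.finite_range s)
  obtain ⟨g, hg⟩ := Submodule.exists_linearEquiv_restrict_eq
    (hs.linearCombinationEquiv.symm ≪≫ₗ ht.linearCombinationEquiv)
  refine ⟨g, funext fun i ↦ ?_⟩
  have hi := hg (hs.linearCombinationEquiv (Finsupp.single i 1))
  simpa using hi.symm

/-- The linearly independent families fixed by `g` are those of the subspace fixed by `g`. -/
noncomputable def fixedByLinearIndependentEquiv (ι : Type*) (g : V ≃ₗ[K] V) :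
    letI := linearIndependentMulAction K V ι
    MulAction.fixedBy {s : ι → V // LinearIndependent K s} g ≃
      {s : ι → LinearMap.ker (g.toLinearMap - LinearMap.id) // LinearIndependent K s} where
  toFun s := ⟨fun i ↦ ⟨s.1.1 i, by
      have h : g (s.1.1 i) = s.1.1 i := congrFun (congrArg Subtype.val s.2) i
      simp [h]⟩,
    LinearIndependent.of_comp (Submodule.subtype _) s.1.2⟩
  invFun s := ⟨⟨fun i ↦ s.1 i, s.2.map' (Submodule.subtype _) (Submodule.ker_subtype _)⟩, by
    refine Subtype.ext (funext fun i ↦ ?_)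
    have h := (s.1 i).2
    rw [LinearMap.mem_ker, LinearMap.sub_apply, sub_eq_zero] at h
    exact h⟩
  left_inv _ := rfl
  right_inv _ := rfl

variable [Finite V]

theorem sum_card_linearIndependent_fixed [Fintype K] [Fintype (V ≃ₗ[K] V)] {k : ℕ}
    (hk : k ≤ finrank K V) :
    ∑ g : V ≃ₗ[K] V,
      Nat.card {s : Fin k → LinearMap.ker (g.toLinearMap - LinearMap.id) // LinearIndependent K s}
      = Nat.card (V ≃ₗ[K] V) := by
  classical
  let := linearIndependentMulAction K V (Fin k)
  let X := {s : Fin k → V // LinearIndependent K s}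
  have : Fintype X := Fintype.ofFinite _
  have : MulAction.IsPretransitive (V ≃ₗ[K] V) X := ⟨fun s t ↦ by
    obtain ⟨g, hg⟩ := s.2.exists_linearEquiv_comp_eq t.2
    exact ⟨g, Subtype.ext hg⟩⟩
  have : Nonempty X := by
    have b := finBasis K V
    exact ⟨⟨b ∘ Fin.castLE hk, b.linearIndependent.comp _ (Fin.castLE_injective hk)⟩⟩
  have : Unique (MulAction.orbitRel.Quotient (V ≃ₗ[K] V) X) :=
    ((MulAction.pretransitive_iff_unique_quotient_of_nonempty _ _).1 inferInstance).some
  have : ∀ g : V ≃ₗ[K] V, Fintype (MulAction.fixedBy X g) := fun g ↦ Fintype.ofFinite _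
  have : Fintype (Quotient (MulAction.orbitRel (V ≃ₗ[K] V) X)) := Fintype.ofFinite _
  have h := MulAction.sum_card_fixedBy_eq_card_orbits_mul_card_group (V ≃ₗ[K] V) X
  have h1 : Fintype.card (Quotient (MulAction.orbitRel (V ≃ₗ[K] V) X)) = 1 :=
    Fintype.card_eq_one_iff_nonempty_unique.2 ⟨‹_›⟩
  rw [h1, one_mul, ← Nat.card_eq_fintype_card] at h
  rw [← h]
  refine sum_congr rfl fun g _ ↦ ?_
  rw [← Nat.card_eq_fintype_card, Nat.card_congr (fixedByLinearIndependentEquiv (Fin k) g)]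

end Burnside

/-- The product `(q - 1) (q ^ 2 - 1) ⋯ (q ^ n - 1)`. -/
def qPochhammer (q : ℚ) (n : ℕ) : ℚ := ∏ i ∈ range n, (q ^ (i + 1) - 1)

theorem qPochhammer_ne_zero {q : ℚ} (hq : 1 < q) (n : ℕ) : qPochhammer q n ≠ 0 :=
  prod_ne_zero_iff.2 fun i _ ↦ (sub_pos.2 (one_lt_pow₀ hq i.succ_ne_zero)).ne'

theorem qPochhammer_succ (q : ℚ) (n : ℕ) :
    qPochhammer q (n + 1) = qPochhammer q n * (q ^ (n + 1) - 1) :=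
  prod_range_succ _ _

theorem sum_prod_sub_pow_div_qPochhammer {q : ℚ} (hq : 1 < q) (x : ℚ) (m : ℕ) :
    ∑ k ∈ range (m + 1), (-1) ^ k * (∏ i ∈ range k, (x - q ^ i)) / qPochhammer q k
      = (-1) ^ m * (∏ i ∈ range m, (x - q ^ (i + 1))) / qPochhammer q m := by
  induction m with
  | zero => simp
  | succ m ih =>
    have h1 := qPochhammer_ne_zero hq m
    have h2 := qPochhammer_ne_zero hq (m + 1)
    rw [sum_range_succ, ih, prod_range_succ' (fun i ↦ x - q ^ i),
      prod_range_succ (fun i ↦ x - q ^ (i + 1))]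
    rw [qPochhammer_succ] at h2 ⊢
    have h3 := right_ne_zero_of_mul h2
    field_simp
    ring

theorem card_linearIndependent_cast (K V : Type*) [Field K] [Fintype K] [AddCommGroup V]
    [Module K V] [Finite V] (k : ℕ) :
    (Nat.card {s : Fin k → V // LinearIndependent K s} : ℚ)
      = ∏ i ∈ range k, ((Fintype.card K : ℚ) ^ finrank K V - (Fintype.card K : ℚ) ^ i) := by
  by_cases hk : k ≤ finrank K V
  · rw [card_linearIndependent hk, Nat.cast_prod,
      ← Fin.prod_univ_eq_prod_range
        (fun i ↦ (Fintype.card K : ℚ) ^ finrank K V - (Fintype.card K : ℚ) ^ i)]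
    refine prod_congr rfl fun i _ ↦ ?_
    rw [Nat.cast_sub (Nat.pow_le_pow_right Fintype.card_pos (i.2.le.trans hk))]
    push_cast
    rfl
  · have : IsEmpty {s : Fin k → V // LinearIndependent K s} :=
      ⟨fun s ↦ hk (by simpa using s.2.fintype_card_le_finrank)⟩
    rw [Nat.card_of_isEmpty, Nat.cast_zero, eq_comm]
    exact prod_eq_zero (mem_range.2 (not_le.1 hk)) (sub_self _)

theorem sum_card_linearIndependent_div_qPochhammer (K V : Type*) [Field K] [Fintype K]
    [AddCommGroup V] [Module K V] [Finite V] {n : ℕ} (hn : finrank K V ≤ n) :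
    ∑ k ∈ range (n + 1), (-1) ^ k * (Nat.card {s : Fin k → V // LinearIndependent K s} : ℚ)
      / qPochhammer (Fintype.card K) k = if finrank K V = 0 then 1 else 0 := by
  have hq : (1 : ℚ) < Fintype.card K := by exact_mod_cast Fintype.one_lt_card
  simp_rw [card_linearIndependent_cast]
  rw [sum_prod_sub_pow_div_qPochhammer hq]
  split_ifs with h
  · rw [div_eq_one_iff_eq (qPochhammer_ne_zero hq n), h, qPochhammer, ← card_range n,
      ← prod_const, card_range, ← prod_mul_distrib]
    refine prod_congr rfl fun i _ ↦ ?_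
    ring
  · obtain ⟨d, hd⟩ := Nat.exists_eq_succ_of_ne_zero h
    rw [prod_eq_zero (i := d) (mem_range.2 (by omega)) (by rw [hd, sub_self]), mul_zero, zero_div]

/-- Matrices over `F` with neither eigenvalue `0` nor `1` are linear automorphisms without nonzero
fixed vectors. -/
theorem linDerCount_eq_card (F : Type) [Field F] [Fintype F] (n : ℕ) :
    linDerCount F n = Nat.card {g : (Fin n → F) ≃ₗ[F] (Fin n → F) //
      finrank F (LinearMap.ker (g.toLinearMap - LinearMap.id)) = 0} := by
  have key (A : Matrix (Fin n) (Fin n) F) :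
      IsUnit A ↔ Function.Injective (Matrix.toLin' A) := by
    rw [← Matrix.mulVec_injective_iff_isUnit]
    rfl
  have key' (B : (Fin n → F) →ₗ[F] (Fin n → F)) :
      IsUnit (LinearMap.toMatrix' B - 1) ↔
        finrank F (LinearMap.ker (B - LinearMap.id)) = 0 := by
    rw [key, map_sub, Matrix.toLin'_toMatrix', Matrix.toLin'_one, ← LinearMap.ker_eq_bot,
      Submodule.finrank_eq_zero]
  refine (Nat.card_eq_of_bijective
    (fun g ↦ ⟨LinearMap.toMatrix' g.1.toLinearMap,
      (key _).2 (by rw [Matrix.toLin'_toMatrix']; exact g.1.injective), (key' _).2 g.2⟩)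
    ⟨fun g h hgh ↦ ?_, fun A ↦ ?_⟩).symm
  · refine Subtype.ext (LinearEquiv.toLinearMap_injective ?_)
    exact LinearMap.toMatrix'.injective (congrArg Subtype.val hgh)
  · have hg : (LinearEquiv.ofInjectiveEndo (Matrix.toLin' A.1)
        ((key A.1).1 A.2.1)).toLinearMap = Matrix.toLin' A.1 := LinearMap.ext fun _ ↦ rfl
    refine ⟨⟨LinearEquiv.ofInjectiveEndo (Matrix.toLin' A.1) ((key A.1).1 A.2.1), ?_⟩, ?_⟩
    · rw [← key', hg, LinearMap.toMatrix'_toLin']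
      exact A.2.2
    · refine Subtype.ext ?_
      simp only [hg, LinearMap.toMatrix'_toLin']

theorem linDerCount_eq_card_mul_sum (F : Type) [Field F] [Fintype F] (n : ℕ) :
    (linDerCount F n : ℚ) = (Nat.card ((Fin n → F) ≃ₗ[F] (Fin n → F)) : ℚ) *
      ∑ k ∈ range (n + 1), (-1) ^ k / qPochhammer (Fintype.card F) k := by
  classical
  have : Finite ((Fin n → F) ≃ₗ[F] (Fin n → F)) := DFunLike.finite _
  let := Fintype.ofFinite ((Fin n → F) ≃ₗ[F] (Fin n → F))
  rw [linDerCount_eq_card, Nat.card_eq_fintype_card, Fintype.card_subtype, card_filter,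
    Nat.cast_sum, mul_sum]
  have hn : finrank F (Fin n → F) = n := by simp
  have h (g : (Fin n → F) ≃ₗ[F] (Fin n → F)) :=
    sum_card_linearIndependent_div_qPochhammer F
      (LinearMap.ker (g.toLinearMap - LinearMap.id)) ((Submodule.finrank_le _).trans hn.le)
  simp_rw [Nat.cast_ite, Nat.cast_one, Nat.cast_zero, ← h]
  rw [sum_comm]
  refine sum_congr rfl fun k hk ↦ ?_
  rw [← sum_div, ← mul_sum, ← Nat.cast_sum, sum_card_linearIndependent_fixed
    (by rw [hn]; exact Nat.lt_succ_iff.1 (mem_range.1 hk))]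
  ring

theorem card_linearEquiv_pi (F : Type) [Field F] [Fintype F] (n : ℕ) :
    (Nat.card ((Fin n → F) ≃ₗ[F] (Fin n → F)) : ℚ)
      = (Fintype.card F : ℚ) ^ (n * (n - 1) / 2) * qPochhammer (Fintype.card F) n := by
  have e : GL (Fin n) F ≃ ((Fin n → F) ≃ₗ[F] (Fin n → F)) :=
    (Matrix.GeneralLinearGroup.toLin.trans
      (LinearMap.GeneralLinearGroup.generalLinearEquiv F (Fin n → F))).toEquiv
  rw [← Nat.card_congr e, Nat.card_congr (Matrix.equiv_GL_linearindependent n),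
    card_linearIndependent_cast, finrank_fin_fun, qPochhammer, ← sum_range_id, ← prod_pow_eq_pow_sum,
    ← prod_range_reflect (fun i ↦ (Fintype.card F : ℚ) ^ (i + 1) - 1), ← prod_mul_distrib]
  refine prod_congr rfl fun i hi ↦ ?_
  have hi := mem_range.1 hi
  rw [mul_sub, ← pow_add, mul_one]
  congr 2
  omega

theorem linDerCount_div_pow (F : Type) [Field F] [Fintype F] (n : ℕ) :
    (linDerCount F n : ℚ) / (Fintype.card F : ℚ) ^ (n * (n - 1) / 2)
      = qPochhammer (Fintype.card F) n *
        ∑ k ∈ range (n + 1), (-1) ^ k / qPochhammer (Fintype.card F) k := by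
  have hq : (Fintype.card F : ℚ) ≠ 0 := by exact_mod_cast Fintype.card_ne_zero
  rw [linDerCount_eq_card_mul_sum, card_linearEquiv_pi, mul_assoc,
    mul_div_cancel_left₀ _ (pow_ne_zero _ hq)]

theorem linDerCount_div_pow_zero (F : Type) [Field F] [Fintype F] :
    (linDerCount F 0 : ℚ) / (Fintype.card F : ℚ) ^ (0 * (0 - 1) / 2) = 1 := by
  rw [linDerCount_div_pow]
  simp [qPochhammer]

theorem linDerCount_div_pow_succ (F : Type) [Field F] [Fintype F] (n : ℕ) :
    (linDerCount F (n + 1) : ℚ) / (Fintype.card F : ℚ) ^ ((n + 1) * (n + 1 - 1) / 2)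
      = (linDerCount F n : ℚ) / (Fintype.card F : ℚ) ^ (n * (n - 1) / 2)
          * ((Fintype.card F : ℚ) ^ (n + 1) - 1) + (-1) ^ (n + 1) := by
  have hq : (1 : ℚ) < Fintype.card F := by exact_mod_cast Fintype.one_lt_card
  rw [linDerCount_div_pow, linDerCount_div_pow, sum_range_succ, mul_add,
    mul_div_cancel₀ _ (qPochhammer_ne_zero hq (n + 1)), qPochhammer_succ]
  ring

theorem exists_int_linDerCount_div_pow (F : Type) [Field F] [Fintype F] (n : ℕ) :
    ∃ a : ℤ, (linDerCount F n : ℚ) / (Fintype.card F : ℚ) ^ (n * (n - 1) / 2) = a := by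
  induction n with
  | zero => exact ⟨1, by rw [linDerCount_div_pow_zero, Int.cast_one]⟩
  | succ n ih =>
    obtain ⟨a, ha⟩ := ih
    refine ⟨a * ((Fintype.card F : ℤ) ^ (n + 1) - 1) + (-1) ^ (n + 1), ?_⟩
    rw [linDerCount_div_pow_succ, ha]
    push_cast
    rfl

theorem linDerCount_div_recursion {F : Type} [Field F] [Fintype F] (q : ℕ)
    (hq : Fintype.card F = q) :
    (∀ n : ℕ, (q : ℤ) ^ (n * (n - 1) / 2) ∣ (linDerCount F n : ℤ)) ∧
    (linDerCount F 0 : ℚ) / (q : ℚ) ^ (0 * (0 - 1) / 2) = 1 ∧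
    ∀ n : ℕ, 1 ≤ n →
      (linDerCount F n : ℚ) / (q : ℚ) ^ (n * (n - 1) / 2)
        = (linDerCount F (n - 1) : ℚ) / (q : ℚ) ^ ((n - 1) * (n - 1 - 1) / 2)
            * ((q : ℚ) ^ n - 1) + (-1) ^ n := by
  subst hq
  refine ⟨fun n ↦ ?_, linDerCount_div_pow_zero F, fun n hn ↦ ?_⟩
  · obtain ⟨a, ha⟩ := exists_int_linDerCount_div_pow F n
    have hq : (Fintype.card F : ℚ) ≠ 0 := by exact_mod_cast Fintype.card_ne_zero
    rw [div_eq_iff (pow_ne_zero _ hq)] at ha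
    exact ⟨a, by rw [mul_comm]; exact_mod_cast ha⟩
  · obtain ⟨m, rfl⟩ := Nat.exists_eq_add_of_le' hn
    exact linDerCount_div_pow_succ F m
end

section
/- Let e_n denote the number of n×n linear derangements over 𝔽_q. Then the sequence e_n/q^{n²} converges as n → ∞, and lim_{n→∞} e_n/q^{n²} = (∏_{r≥1} (1 − q^{−r}))² (the square of an infinite product of real numbers). -/
open Finset Filter Topology

/-- The coefficients `∏ i = 1, …, k, 1 / (1 - x ^ i)` of Euler's `q`-exponential series. -/
noncomputable def eulerCoeff (x : ℝ) (k : ℕ) : ℝ :=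
  ∏ i ∈ range k, (1 - x ^ (i + 1))⁻¹

lemma one_sub_pow_succ_ne_zero {x : ℝ} (hx : 1 < x) (k : ℕ) : 1 - x ^ (k + 1) ≠ 0 :=
  (sub_neg.2 (one_lt_pow₀ hx k.succ_ne_zero)).ne

lemma eulerCoeff_zero (x : ℝ) : eulerCoeff x 0 = 1 := by simp [eulerCoeff]

lemma eulerCoeff_succ (x : ℝ) (k : ℕ) :
    eulerCoeff x (k + 1) = eulerCoeff x k * (1 - x ^ (k + 1))⁻¹ :=
  prod_range_succ _ _

lemma sum_eulerCoeff_mul_prod {x : ℝ} (hx : 1 < x) (y : ℝ) (m : ℕ) :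
    ∑ k ∈ range (m + 1), eulerCoeff x k * ∏ i ∈ range k, (y - x ^ i) =
      eulerCoeff x m * ∏ i ∈ range m, (y - x ^ (i + 1)) := by
  induction m with
  | zero => simp
  | succ m ih =>
    have h := one_sub_pow_succ_ne_zero hx m
    rw [sum_range_succ, ih, prod_range_succ', prod_range_succ, eulerCoeff_succ]
    field_simp
    ring

lemma summable_norm_eulerCoeff {x : ℝ} (hx : 1 < x) : Summable fun k => ‖eulerCoeff x k‖ := by
  have hne : ∀ k, eulerCoeff x k ≠ 0 := fun k =>
    prod_ne_zero_iff.2 fun i _ => inv_ne_zero (one_sub_pow_succ_ne_zero hx i)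
  refine (summable_of_ratio_test_tendsto_lt_one zero_lt_one
    (Eventually.of_forall hne) ?_).norm
  have h : ∀ k, ‖eulerCoeff x (k + 1)‖ / ‖eulerCoeff x k‖ = ‖1 - x ^ (k + 1)‖⁻¹ := fun k => by
    rw [eulerCoeff_succ, norm_mul, norm_inv, mul_div_cancel_left₀ _ (norm_ne_zero_iff.2 (hne k))]
  simp_rw [h]
  refine Tendsto.inv_tendsto_atTop (tendsto_abs_atBot_atTop.comp ?_)
  exact tendsto_atBot_add_const_left _ _ (tendsto_neg_atTop_atBot.comp
    ((tendsto_pow_atTop_atTop_of_one_lt hx).comp (tendsto_add_atTop_nat 1)))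

lemma summable_eulerCoeff_mul_pow {x : ℝ} (hx : 1 < x) {y : ℝ} (hy : |y| ≤ 1) :
    Summable fun k => eulerCoeff x k * y ^ k := by
  refine Summable.of_norm_bounded (summable_norm_eulerCoeff hx) fun k => ?_
  rw [norm_mul, norm_pow]
  exact mul_le_of_le_one_right (norm_nonneg _) (pow_le_one₀ (norm_nonneg _) hy)

/-- Functional equation of Euler's `q`-exponential. -/
lemma tsum_eulerCoeff_mul_pow {x : ℝ} (hx : 1 < x) {y : ℝ} (hy : |x * y| ≤ 1) :
    ∑' k, eulerCoeff x k * (x * y) ^ k = (1 - y) * ∑' k, eulerCoeff x k * y ^ k := by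
  have hy' : |y| ≤ 1 := by
    rw [abs_mul, abs_of_pos (by linarith)] at hy
    nlinarith [abs_nonneg y]
  have h1 := summable_eulerCoeff_mul_pow hx hy
  have h2 := summable_eulerCoeff_mul_pow hx hy'
  rw [sub_mul, one_mul, ← tsum_mul_left, h1.tsum_eq_zero_add, h2.tsum_eq_zero_add, add_sub_assoc,
    ← Summable.tsum_sub ((summable_nat_add_iff 1).2 h2) (h2.mul_left y)]
  simp only [pow_zero]
  congr 1
  refine tsum_congr fun k => ?_
  have h := one_sub_pow_succ_ne_zero hx k
  rw [eulerCoeff_succ, mul_pow]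
  field_simp
  ring

lemma tsum_eulerCoeff {x : ℝ} (hx : 1 < x) :
    ∑' k, eulerCoeff x k = ∏' r : ℕ, (1 - x⁻¹ ^ (r + 1)) := by
  have hx0 : 0 < x := by linarith
  have hi0 : 0 ≤ x⁻¹ := inv_nonneg.2 hx0.le
  have hi1 : x⁻¹ < 1 := inv_lt_one_of_one_lt₀ hx
  have hmul : Multipliable fun r : ℕ => 1 - x⁻¹ ^ (r + 1) := by
    simp_rw [sub_eq_add_neg]
    apply multipliable_one_add_of_summable
    simpa [abs_of_pos hx0] using
      (summable_nat_add_iff 1).2 (summable_geometric_of_lt_one hi0 hi1)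
  have hprod : ∀ N, ∑' k, eulerCoeff x k =
      (∏ r ∈ range N, (1 - x⁻¹ ^ (r + 1))) * ∑' k, eulerCoeff x k * (x⁻¹ ^ N) ^ k := by
    intro N
    induction N with
    | zero => simp
    | succ N ih =>
      have h : x * x⁻¹ ^ (N + 1) = x⁻¹ ^ N := by
        rw [pow_succ', mul_inv_cancel_left₀ hx0.ne']
      have hb : |x * x⁻¹ ^ (N + 1)| ≤ 1 := by
        rw [h, abs_of_nonneg (pow_nonneg hi0 _)]
        exact pow_le_one₀ hi0 hi1.le
      rw [ih, prod_range_succ, mul_assoc, ← tsum_eulerCoeff_mul_pow hx hb, h]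
  have hlim : Tendsto (fun N : ℕ => ∑' k, eulerCoeff x k * (x⁻¹ ^ N) ^ k) atTop (𝓝 1) := by
    have h1 : ∑' k, eulerCoeff x k * (0 : ℝ) ^ k = 1 := by
      rw [tsum_eq_single 0 (fun k hk => by simp [hk])]
      simp [eulerCoeff_zero]
    rw [← h1]
    refine tendsto_tsum_of_dominated_convergence (summable_norm_eulerCoeff hx) (fun k => ?_)
      (Eventually.of_forall fun N k => ?_)
    · exact ((tendsto_pow_atTop_nhds_zero_of_lt_one hi0 hi1).pow k).const_mul _
    · rw [norm_mul, norm_pow]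
      refine mul_le_of_le_one_right (norm_nonneg _) (pow_le_one₀ (norm_nonneg _) ?_)
      rw [Real.norm_of_nonneg (pow_nonneg hi0 _)]
      exact pow_le_one₀ hi0 hi1.le
  have h := hmul.hasProd.tendsto_prod_nat.mul hlim
  simp_rw [← hprod, mul_one] at h
  exact tendsto_nhds_unique tendsto_const_nhds h

/-- Dominated convergence for the double series attached to linear derangements. -/
lemma tendsto_tsum_eulerCoeff_mul_prod {x : ℝ} (hx : 1 < x) :
    Tendsto (fun n : ℕ => ∑' p : ℕ × ℕ, eulerCoeff x p.1 * eulerCoeff x p.2 *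
      ∏ i ∈ range (p.1 + p.2), (1 - x ^ i / x ^ n)) atTop
      (𝓝 ((∑' k, eulerCoeff x k) ^ 2)) := by
  have hs := summable_norm_eulerCoeff hx
  rw [sq, tsum_mul_tsum_of_summable_norm hs hs]
  refine tendsto_tsum_of_dominated_convergence
    (bound := fun p : ℕ × ℕ => ‖eulerCoeff x p.1‖ * ‖eulerCoeff x p.2‖)
    (hs.mul_of_nonneg hs (fun _ => norm_nonneg _) fun _ => norm_nonneg _) (fun p => ?_)
    (Eventually.of_forall fun n p => ?_)
  · have h : Tendsto (fun n : ℕ => ∏ i ∈ range (p.1 + p.2), (1 - x ^ i / x ^ n)) atTop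
        (𝓝 (∏ i ∈ range (p.1 + p.2), (1 - 0))) :=
      tendsto_finsetProd _ fun i _ => tendsto_const_nhds.sub
        (tendsto_const_nhds.div_atTop (tendsto_pow_atTop_atTop_of_one_lt hx))
    simpa using h.const_mul (eulerCoeff x p.1 * eulerCoeff x p.2)
  · rw [norm_mul, norm_mul]
    refine mul_le_of_le_one_right (by positivity) ?_
    rcases lt_or_ge n (p.1 + p.2) with h | h
    · rw [prod_eq_zero (mem_range.2 h) (by rw [div_self (by positivity), sub_self])]
      simp
    · rw [norm_prod]
      refine prod_le_one (fun _ _ => norm_nonneg _) fun i hi => ?_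
      have h1 : x ^ i / x ^ n ≤ 1 :=
        div_le_one_of_le₀ (pow_le_pow_right₀ hx.le ((mem_range.1 hi).le.trans h)) (by positivity)
      have h0 : 0 ≤ x ^ i / x ^ n := by positivity
      rw [Real.norm_of_nonneg (sub_nonneg.2 h1)]
      linarith

section Counting

variable {F V : Type*} [Field F] [AddCommGroup V] [Module F V]

lemma Submodule.card_linearIndependent_mem (K : Submodule F V) (ι : Type*) :
    Nat.card {v : ι → V // LinearIndependent F v ∧ ∀ i, v i ∈ K} =
      Nat.card {v : ι → K // LinearIndependent F v} :=
  Nat.card_congr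
    { toFun := fun v => ⟨fun i => ⟨v.1 i, v.2.2 i⟩,
        LinearIndependent.of_comp K.subtype v.2.1⟩
      invFun := fun v => ⟨fun i => v.1 i,
        v.2.map' K.subtype K.ker_subtype, fun i => (v.1 i).2⟩
      left_inv := fun _ => rfl
      right_inv := fun _ => rfl }

lemma LinearIndependent.exists_linearMap_eq {ι : Type*} {u : ι → V}
    (hu : LinearIndependent F u) (w : ι → V) : ∃ A : Module.End F V, ∀ i, A (u i) = w i := by
  obtain ⟨g, hg⟩ := LinearMap.exists_leftInverse_of_injective _
    (linearIndependent_iff_ker.1 hu)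
  refine ⟨Finsupp.linearCombination F w ∘ₗ g, fun i => ?_⟩
  have h := LinearMap.congr_fun hg (Finsupp.single i 1)
  simp only [LinearMap.comp_apply, Finsupp.linearCombination_single, one_smul,
    LinearMap.id_apply] at h
  simp [h]

lemma Module.End.card_linearIndependent_ker_mul (A : Module.End F V) (k l : ℕ) :
    Nat.card {v : Fin k → V // LinearIndependent F v ∧ ∀ i, v i ∈ LinearMap.ker A} *
      Nat.card {v : Fin l → V // LinearIndependent F v ∧ ∀ i, v i ∈ LinearMap.ker (A - 1)} =
    Nat.card {u : Fin k ⊕ Fin l → V // LinearIndependent F u ∧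
      ∀ s, A (u s) = Sum.elim (fun _ => 0) (u ∘ Sum.inr) s} := by
  have hdisj : Disjoint (LinearMap.ker A) (LinearMap.ker (A - 1)) := by
    rw [Submodule.disjoint_def]
    intro x hx hx'
    rw [LinearMap.mem_ker] at hx
    simpa [LinearMap.mem_ker, hx] using hx'
  rw [← Nat.card_prod]
  refine Nat.card_congr
    { toFun := fun p => ⟨Sum.elim p.1.1 p.2.1, ?_, ?_⟩
      invFun := fun u => (⟨u.1 ∘ Sum.inl, u.2.1.comp _ Sum.inl_injective, fun i => ?_⟩,
        ⟨u.1 ∘ Sum.inr, u.2.1.comp _ Sum.inr_injective, fun i => ?_⟩)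
      left_inv := fun p => rfl
      right_inv := fun u => Subtype.ext (Sum.elim_comp_inl_inr _) }
  · exact p.1.2.1.sum_type p.2.2.1 (hdisj.mono
      (Submodule.span_le.2 (Set.range_subset_iff.2 p.1.2.2))
      (Submodule.span_le.2 (Set.range_subset_iff.2 p.2.2.2)))
  · rintro (i | i)
    · exact LinearMap.mem_ker.1 (p.1.2.2 i)
    · exact sub_eq_zero.1 (LinearMap.mem_ker.1 (p.2.2.2 i))
  · exact LinearMap.mem_ker.2 (u.2.2 (Sum.inl i))
  · exact LinearMap.mem_ker.2 (sub_eq_zero.2 (u.2.2 (Sum.inr i)))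

lemma LinearIndependent.card_linearMap_eq {ι : Type*} [Fintype ι] {u : ι → V}
    (hu : LinearIndependent F u) (w : ι → V) :
    Nat.card V ^ Fintype.card ι * Nat.card {A : Module.End F V // ∀ i, A (u i) = w i} =
      Nat.card (Module.End F V) := by
  let g : Module.End F V →ₗ[F] ι → V := LinearMap.pi fun i => LinearMap.applyₗ (u i)
  have hg : Function.Surjective g := fun w =>
    let ⟨A, hA⟩ := hu.exists_linearMap_eq w
    ⟨A, funext hA⟩
  obtain ⟨A₀, hA₀⟩ := hu.exists_linearMap_eq w
  have e : {A : Module.End F V // ∀ i, A (u i) = w i} ≃ LinearMap.ker g :=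
    (Equiv.subRight A₀).subtypeEquiv fun A => by
      simp [g, LinearMap.mem_ker, funext_iff, hA₀, sub_eq_zero]
  rw [Nat.card_congr e, Submodule.card_eq_card_quotient_mul_card (LinearMap.ker g),
    Nat.card_congr (g.quotKerEquivOfSurjective hg).toEquiv, Nat.card_fun,
    Nat.card_eq_fintype_card (α := ι), mul_comm]

variable [Finite V] [Fintype F]

lemma card_linearIndependent_eq_prod (ι : Type*) [Fintype ι] :
    (Nat.card {v : ι → V // LinearIndependent F v} : ℝ) =
      ∏ i ∈ range (Fintype.card ι),
        ((Fintype.card F : ℝ) ^ Module.finrank F V - (Fintype.card F : ℝ) ^ i) := by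
  have e : {v : ι → V // LinearIndependent F v} ≃
      {v : Fin (Fintype.card ι) → V // LinearIndependent F v} :=
    (Equiv.arrowCongr (Fintype.equivFin ι) (Equiv.refl V)).subtypeEquiv fun v =>
      (linearIndependent_equiv (Fintype.equivFin ι).symm).symm
  rw [Nat.card_congr e]
  rcases le_or_gt (Fintype.card ι) (Module.finrank F V) with h | h
  · rw [card_linearIndependent h, Nat.cast_prod, ← Fin.prod_univ_eq_prod_range
      (fun i => (Fintype.card F : ℝ) ^ Module.finrank F V - (Fintype.card F : ℝ) ^ i)]
    refine prod_congr rfl fun i _ => ?_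
    rw [Nat.cast_sub (Nat.pow_le_pow_right Fintype.card_pos (i.2.le.trans h))]
    push_cast
    rfl
  · rw [prod_eq_zero (mem_range.2 h) (sub_self _), Nat.cast_eq_zero]
    have : IsEmpty {v : Fin (Fintype.card ι) → V // LinearIndependent F v} :=
      ⟨fun v => h.not_ge (by simpa using v.2.fintype_card_le_finrank)⟩
    exact Nat.card_of_isEmpty

open Classical in
/-- Möbius inversion on the lattice of subspaces, in terms of independent families. -/
lemma Submodule.sum_eulerCoeff_mul_card_linearIndependent (K : Submodule F V) {n : ℕ}
    (hn : Module.finrank F V ≤ n) :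
    ∑ k ∈ range (n + 1), eulerCoeff (Fintype.card F) k *
      Nat.card {v : Fin k → V // LinearIndependent F v ∧ ∀ i, v i ∈ K} =
      if K = ⊥ then 1 else 0 := by
  have hq : (1 : ℝ) < Fintype.card F := mod_cast Fintype.one_lt_card
  simp_rw [K.card_linearIndependent_mem, card_linearIndependent_eq_prod, Fintype.card_fin]
  rw [sum_eulerCoeff_mul_prod hq]
  split_ifs with h
  · rw [h, finrank_bot, pow_zero, eulerCoeff, ← prod_mul_distrib]
    exact prod_eq_one fun i _ => inv_mul_cancel₀ (one_sub_pow_succ_ne_zero hq i)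
  · obtain ⟨d, hd⟩ := Nat.exists_eq_succ_of_ne_zero (mt Submodule.finrank_eq_zero.1 h)
    have hdn : d < n := by have := K.finrank_le; omega
    rw [hd, prod_eq_zero (mem_range.2 hdn) (sub_self _), mul_zero]

lemma Module.End.sum_card_linearIndependent_ker_mul [Fintype (Module.End F V)] (k l : ℕ) :
    (∑ A : Module.End F V,
      (Nat.card {v : Fin k → V // LinearIndependent F v ∧ ∀ i, v i ∈ LinearMap.ker A} : ℝ) *
      Nat.card {v : Fin l → V // LinearIndependent F v ∧ ∀ i, v i ∈ LinearMap.ker (A - 1)}) =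
    Nat.card (Module.End F V) * ∏ i ∈ range (k + l),
      (1 - (Fintype.card F : ℝ) ^ i / (Fintype.card F : ℝ) ^ Module.finrank F V) := by
  classical
  have hq : (Fintype.card F : ℝ) ≠ 0 := mod_cast Fintype.card_ne_zero
  have hV : Nat.card V = Fintype.card F ^ Module.finrank F V := by
    rw [Module.natCard_eq_pow_finrank (K := F), Nat.card_eq_fintype_card]
  have e : (Σ A : Module.End F V, {u : Fin k ⊕ Fin l → V // LinearIndependent F u ∧
      ∀ s, A (u s) = Sum.elim (fun _ => 0) (u ∘ Sum.inr) s}) ≃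
      Σ u : {u : Fin k ⊕ Fin l → V // LinearIndependent F u},
        {A : Module.End F V // ∀ s, A (u.1 s) = Sum.elim (fun _ => 0) (u.1 ∘ Sum.inr) s} :=
    { toFun := fun p => ⟨⟨p.2.1, p.2.2.1⟩, p.1, p.2.2.2⟩
      invFun := fun p => ⟨p.2.1, p.1.1, p.1.2, p.2.2⟩
      left_inv := fun _ => rfl
      right_inv := fun _ => rfl }
  have := Fintype.ofFinite {u : Fin k ⊕ Fin l → V // LinearIndependent F u}
  have hfib : ∀ u : {u : Fin k ⊕ Fin l → V // LinearIndependent F u},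
      (Nat.card {A : Module.End F V //
        ∀ s, A (u.1 s) = Sum.elim (fun _ => 0) (u.1 ∘ Sum.inr) s} : ℝ) =
      Nat.card (Module.End F V) / (Nat.card V : ℝ) ^ (k + l) := fun u => by
    rw [eq_div_iff (by rw [hV]; positivity), mul_comm,
      ← u.2.card_linearMap_eq (Sum.elim (fun _ => 0) (u.1 ∘ Sum.inr))]
    simp
  simp_rw [← Nat.cast_mul, Module.End.card_linearIndependent_ker_mul]
  rw [← Nat.cast_sum, ← Nat.card_sigma, Nat.card_congr e, Nat.card_sigma, Nat.cast_sum,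
    sum_congr rfl fun u _ => hfib u, sum_const, nsmul_eq_mul, card_univ,
    ← Nat.card_eq_fintype_card, card_linearIndependent_eq_prod, Fintype.card_sum,
    Fintype.card_fin, Fintype.card_fin, mul_div_left_comm, hV, ← card_range (k + l),
    ← prod_const, card_range, ← prod_div_distrib]
  congr 1
  refine prod_congr rfl fun i _ => ?_
  push_cast
  rw [sub_div, div_self (pow_ne_zero _ hq)]

lemma Module.End.card_isUnit_and_isUnit_sub_one :
    (Nat.card {A : Module.End F V // IsUnit A ∧ IsUnit (A - 1)} : ℝ) =
      Nat.card (Module.End F V) * ∑' p : ℕ × ℕ,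
        eulerCoeff (Fintype.card F) p.1 * eulerCoeff (Fintype.card F) p.2 *
        ∏ i ∈ range (p.1 + p.2),
          (1 - (Fintype.card F : ℝ) ^ i / (Fintype.card F : ℝ) ^ Module.finrank F V) := by
  classical
  have : Finite (Module.End F V) := DFunLike.finite _
  have := Fintype.ofFinite (Module.End F V)
  set n := Module.finrank F V with hn
  have hq : (Fintype.card F : ℝ) ≠ 0 := mod_cast Fintype.card_ne_zero
  rw [tsum_eq_sum (s := range (n + 1) ×ˢ range (n + 1)), Nat.card_eq_fintype_card,
    Fintype.card_subtype, card_filter, Nat.cast_sum, mul_sum, sum_product]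
  · have hind : ∀ A : Module.End F V, ((if IsUnit A ∧ IsUnit (A - 1) then 1 else 0 : ℕ) : ℝ) =
        (if LinearMap.ker A = ⊥ then 1 else 0) * if LinearMap.ker (A - 1) = ⊥ then 1 else 0 :=
      fun A => by
        simp only [LinearMap.isUnit_iff_ker_eq_bot, ite_zero_mul_ite_zero, mul_one,
          Nat.cast_ite, Nat.cast_one, Nat.cast_zero]
    simp_rw [hind, ← Submodule.sum_eulerCoeff_mul_card_linearIndependent _ hn.ge,
      sum_mul_sum]
    rw [sum_comm]
    refine sum_congr rfl fun k _ => ?_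
    rw [sum_comm]
    refine sum_congr rfl fun l _ => ?_
    simp_rw [mul_mul_mul_comm (eulerCoeff _ k)]
    rw [← mul_sum, sum_card_linearIndependent_ker_mul, mul_left_comm]
  · rintro ⟨k, l⟩ h
    have hkl : n < k + l := by
      simp only [mem_product, mem_range, not_and_or] at h
      omega
    rw [prod_eq_zero (mem_range.2 hkl) (by rw [div_self (pow_ne_zero _ hq), sub_self]), mul_zero]

end Counting

lemma linDerCount_div_pow_eq_tsum (F : Type) [Field F] [Fintype F] (n : ℕ) :
    (linDerCount F n : ℝ) / (Fintype.card F : ℝ) ^ (n ^ 2) = ∑' p : ℕ × ℕ,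
      eulerCoeff (Fintype.card F) p.1 * eulerCoeff (Fintype.card F) p.2 *
      ∏ i ∈ range (p.1 + p.2), (1 - (Fintype.card F : ℝ) ^ i / (Fintype.card F : ℝ) ^ n) := by
  have hq : (Fintype.card F : ℝ) ≠ 0 := mod_cast Fintype.card_ne_zero
  let e : Matrix (Fin n) (Fin n) F ≃ₐ[F] Module.End F (Fin n → F) := Matrix.toLinAlgEquiv'
  have h : linDerCount F n =
      Nat.card {A : Module.End F (Fin n → F) // IsUnit A ∧ IsUnit (A - 1)} :=
    Nat.card_congr (e.toEquiv.subtypeEquiv fun A => by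
      change _ ↔ IsUnit (e A) ∧ IsUnit (e A - 1)
      rw [← map_one e, ← map_sub, MulEquiv.isUnit_map, MulEquiv.isUnit_map])
  have hE : Nat.card (Module.End F (Fin n → F)) = Fintype.card F ^ n ^ 2 := by
    rw [← Nat.card_congr (Matrix.of.trans e.toEquiv), Nat.card_fun, Nat.card_fun, Nat.card_fin,
      Nat.card_eq_fintype_card, ← pow_mul, sq]
  rw [h, Module.End.card_isUnit_and_isUnit_sub_one, hE, Nat.cast_pow,
    mul_div_cancel_left₀ _ (pow_ne_zero _ hq), Module.finrank_fin_fun]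

theorem linDerCount_div_card_all_tendsto {F : Type} [Field F] [Fintype F] (q : ℕ)
    (hq : Fintype.card F = q) :
    Filter.Tendsto (fun n : ℕ => (linDerCount F n : ℝ) / (q : ℝ) ^ (n ^ 2)) Filter.atTop
      (nhds ((∏' r : ℕ, (1 - ((q : ℝ))⁻¹ ^ (r + 1))) ^ 2)) := by
  subst hq
  have hq : (1 : ℝ) < Fintype.card F := mod_cast Fintype.one_lt_card
  simp_rw [linDerCount_div_pow_eq_tsum, ← tsum_eulerCoeff hq]
  exact tendsto_tsum_eulerCoeff_mul_prod hq
end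

section
/- Let e_n denote the number of n×n linear derangements over 𝔽_q. Then in ℚ, for every n ≥ 0: e_n/γ_n = 1 + Σ_{i=1}^{n} (−1)^i / ((q − 1)(q² − 1)⋯(q^i − 1)). -/
/-- `gam q n` is the order of `GL_n(F_q)`: `∏_{i=0}^{n-1} (q^n - q^i)`. -/
def gam (q n : ℕ) : ℕ := ∏ i ∈ Finset.range n, (q ^ n - q ^ i)

open Module

section LinearIndependentTuples

variable {K V : Type*} [Field K] [AddCommGroup V] [Module K V]

/-- The general linear group acts on linearly independent families by post-composition. -/
instance linearIndependentMulAction_s4 (ι : Type*) :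
    MulAction (V ≃ₗ[K] V) {v : ι → V // LinearIndependent K v} where
  smul g v := ⟨fun i ↦ g (v.1 i), v.2.map' (g : V →ₗ[K] V) g.ker⟩
  one_smul _ := rfl
  mul_smul _ _ _ := rfl

instance linearIndependent_isPretransitive [FiniteDimensional K V] (ι : Type*) [Finite ι] :
    MulAction.IsPretransitive (V ≃ₗ[K] V) {v : ι → V // LinearIndependent K v} where
  exists_smul_eq v w := by
    have e : Basis.sumExtendIndex v.2 ≃ Basis.sumExtendIndex w.2 := by
      have hv := finrank_eq_nat_card_basis (Basis.sumExtend v.2)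
      have hw := finrank_eq_nat_card_basis (Basis.sumExtend w.2)
      have : Finite (ι ⊕ Basis.sumExtendIndex v.2) :=
        Module.Finite.finite_basis (Basis.sumExtend v.2)
      have : Finite (ι ⊕ Basis.sumExtendIndex w.2) :=
        Module.Finite.finite_basis (Basis.sumExtend w.2)
      have : Finite (Basis.sumExtendIndex v.2) := Finite.sum_right ι
      have : Finite (Basis.sumExtendIndex w.2) := Finite.sum_right ι
      rw [Nat.card_sum] at hv
      rw [Nat.card_sum] at hw
      exact (Finite.card_eq.1 (by lia)).some
    refine ⟨(Basis.sumExtend v.2).equiv (Basis.sumExtend w.2) ((Equiv.refl ι).sumCongr e), ?_⟩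
    ext i
    have hl (u : {v : ι → V // LinearIndependent K v}) :
        (Basis.sumExtend u.2) (Sum.inl i) = u.1 i := by
      simp only [Basis.sumExtend, Basis.reindex_apply, Basis.extend_apply_self]
      rfl
    have := (Basis.sumExtend v.2).equiv_apply (Sum.inl i) (Basis.sumExtend w.2)
      ((Equiv.refl ι).sumCongr e)
    rw [hl, Equiv.sumCongr_apply, Sum.map_inl, Equiv.refl_apply, hl] at this
    exact this

/-- The linearly independent families fixed by `g` are those of the fixed space of `g`. -/
def fixedByEquivLinearIndependent (ι : Type*) (g : V ≃ₗ[K] V) :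
    MulAction.fixedBy {v : ι → V // LinearIndependent K v} g ≃
      {v : ι → LinearMap.ker ((g : V →ₗ[K] V) - 1) // LinearIndependent K v} where
  toFun v := ⟨fun i ↦ ⟨v.1.1 i, by
      have : g (v.1.1 i) = v.1.1 i := congrFun (congrArg Subtype.val v.2) i
      simpa [sub_eq_zero] using this⟩,
    LinearIndependent.of_comp (LinearMap.ker ((g : V →ₗ[K] V) - 1)).subtype v.1.2⟩
  invFun v := ⟨⟨fun i ↦ (v.1 i).1, v.2.map' (Submodule.subtype _) (Submodule.ker_subtype _)⟩, by
    refine Subtype.ext (funext fun i ↦ ?_)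
    have := (v.1 i).2
    rwa [LinearMap.mem_ker, LinearMap.sub_apply, sub_eq_zero] at this⟩
  left_inv _ := rfl
  right_inv _ := rfl

end LinearIndependentTuples

section Counting

variable {K V : Type*} [Field K] [Fintype K] [AddCommGroup V] [Module K V] [Finite V]

theorem card_linearIndependent_rat (k : ℕ) :
    (Nat.card {v : Fin k → V // LinearIndependent K v} : ℚ) =
      ∏ i ∈ Finset.range k, ((Fintype.card K : ℚ) ^ finrank K V - (Fintype.card K : ℚ) ^ i) := by
  have : FiniteDimensional K V := Module.Finite.of_finite
  by_cases hk : k ≤ finrank K V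
  · rw [card_linearIndependent hk, Finset.prod_range, Nat.cast_prod]
    refine Finset.prod_congr rfl fun i _ ↦ ?_
    rw [Nat.cast_sub (Nat.pow_le_pow_right Fintype.card_pos (by lia))]
    simp
  · have : IsEmpty {v : Fin k → V // LinearIndependent K v} :=
      ⟨fun v ↦ hk (by simpa using v.2.fintype_card_le_finrank)⟩
    rw [Nat.card_of_isEmpty, Finset.prod_eq_zero (i := finrank K V) (by simpa using hk) (sub_self _),
      Nat.cast_zero]

/-- Burnside's lemma for the action of the general linear group on independent `k`-tuples. -/
theorem sum_prod_card_pow_finrank_ker_sub [Fintype (V ≃ₗ[K] V)] {k : ℕ} (hk : k ≤ finrank K V) :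
    ∑ g : V ≃ₗ[K] V, ∏ i ∈ Finset.range k,
      ((Fintype.card K : ℚ) ^ finrank K (LinearMap.ker ((g : V →ₗ[K] V) - 1)) -
        (Fintype.card K : ℚ) ^ i) = Nat.card (V ≃ₗ[K] V) := by
  classical
  have : FiniteDimensional K V := Module.Finite.of_finite
  let X := {v : Fin k → V // LinearIndependent K v}
  have : Fintype X := Fintype.ofFinite X
  have hX : Nonempty X :=
    ⟨⟨fun i ↦ finBasis K V (Fin.castLE hk i),
      (finBasis K V).linearIndependent.comp _ (Fin.castLE_injective hk)⟩⟩
  have (g : V ≃ₗ[K] V) : Fintype (MulAction.fixedBy X g) := Fintype.ofFinite _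
  have : Fintype (Quotient (MulAction.orbitRel (V ≃ₗ[K] V) X)) := Fintype.ofFinite _
  have hΩ : Fintype.card (Quotient (MulAction.orbitRel (V ≃ₗ[K] V) X)) = 1 := by
    have : Subsingleton (Quotient (MulAction.orbitRel (V ≃ₗ[K] V) X)) :=
      (MulAction.pretransitive_iff_subsingleton_quotient (V ≃ₗ[K] V) X).1 inferInstance
    have : Nonempty (Quotient (MulAction.orbitRel (V ≃ₗ[K] V) X)) := hX.map (Quotient.mk _)
    rw [← Nat.card_eq_fintype_card]
    exact Nat.card_unique
  have burnside := MulAction.sum_card_fixedBy_eq_card_orbits_mul_card_group (V ≃ₗ[K] V) X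
  rw [hΩ, one_mul] at burnside
  rw [Nat.card_eq_fintype_card, ← burnside, Nat.cast_sum]
  refine Finset.sum_congr rfl fun g _ ↦ ?_
  rw [← card_linearIndependent_rat, ← Nat.card_congr (fixedByEquivLinearIndependent (Fin k) g),
    Nat.card_eq_fintype_card]

end Counting

theorem sum_range_neg_one_pow_div_mul_prod (q : ℚ) (hq : 1 < q) (x : ℚ) (n : ℕ) :
    ∑ k ∈ Finset.range (n + 1), (-1) ^ k / (∏ j ∈ Finset.Icc 1 k, (q ^ j - 1)) *
        ∏ i ∈ Finset.range k, (x - q ^ i) =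
      (-1) ^ n / (∏ j ∈ Finset.Icc 1 n, (q ^ j - 1)) * ∏ i ∈ Finset.range n, (x - q ^ (i + 1)) := by
  induction n with
  | zero => simp
  | succ n ih =>
    have hP : ∏ j ∈ Finset.Icc 1 n, (q ^ j - 1) ≠ 0 := Finset.prod_ne_zero_iff.2 fun j hj ↦
      (sub_pos.2 (one_lt_pow₀ hq (by have := Finset.mem_Icc.1 hj; lia))).ne'
    have hn : q ^ (n + 1) - 1 ≠ 0 := (sub_pos.2 (one_lt_pow₀ hq n.succ_ne_zero)).ne'
    rw [Finset.sum_range_succ, ih, Finset.prod_Icc_succ_top (by lia), Finset.prod_range_succ',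
      Finset.prod_range_succ _ n]
    field_simp
    ring

theorem sum_range_neg_one_pow_div_mul_prod_pow_sub (q : ℚ) (hq : 1 < q) {d n : ℕ} (hd : d ≤ n) :
    ∑ k ∈ Finset.range (n + 1), (-1) ^ k / (∏ j ∈ Finset.Icc 1 k, (q ^ j - 1)) *
        ∏ i ∈ Finset.range k, (q ^ d - q ^ i) = if d = 0 then 1 else 0 := by
  rw [sum_range_neg_one_pow_div_mul_prod q hq]
  split_ifs with h
  · have hP : ∏ j ∈ Finset.Icc 1 n, (q ^ j - 1) ≠ 0 := Finset.prod_ne_zero_iff.2 fun j hj ↦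
      (sub_pos.2 (one_lt_pow₀ hq (by have := Finset.mem_Icc.1 hj; lia))).ne'
    have : ∏ i ∈ Finset.range n, (q ^ d - q ^ (i + 1)) =
        (-1) ^ n * ∏ j ∈ Finset.Icc 1 n, (q ^ j - 1) := by
      rw [← Finset.Ico_add_one_right_eq_Icc, Finset.prod_Ico_eq_prod_range, Nat.add_sub_cancel]
      nth_rw 2 [← Finset.card_range n]
      rw [← Finset.prod_const, ← Finset.prod_mul_distrib]
      exact Finset.prod_congr rfl fun i _ ↦ by rw [h]; ring
    rw [this, div_mul_eq_mul_div, ← mul_assoc, ← mul_pow]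
    simp [hP]
  · rw [Finset.prod_eq_zero (i := d - 1) (Finset.mem_range.2 (by lia))
      (by rw [Nat.sub_add_cancel (by lia), sub_self]), mul_zero]

/-- The matrices counted by `linDerCount` are the automorphisms without nonzero fixed vectors. -/
theorem linDerCount_eq_card_linearEquiv (F : Type) [Field F] [Fintype F] (n : ℕ) :
    linDerCount F n = Nat.card {g : (Fin n → F) ≃ₗ[F] (Fin n → F) //
      finrank F (LinearMap.ker ((g : (Fin n → F) →ₗ[F] (Fin n → F)) - 1)) = 0} := by
  have h (A : Matrix (Fin n) (Fin n) F) : IsUnit (A - 1) ↔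
      finrank F (LinearMap.ker (Matrix.toLin' A - 1)) = 0 := by
    rw [Submodule.finrank_eq_zero, ← LinearMap.isUnit_iff_ker_eq_bot,
      ← isUnit_map_iff (Matrix.toLinAlgEquiv' : Matrix (Fin n) (Fin n) F ≃ₐ[F] _), map_sub, map_one]
    rfl
  symm
  refine Nat.card_congr (Equiv.ofBijective (fun g ↦
    ⟨LinearMap.toMatrix' (g.1 : (Fin n → F) →ₗ[F] (Fin n → F)), ?_, ?_⟩)
    ⟨?_, ?_⟩)
  · exact ((LinearMap.GeneralLinearGroup.generalLinearEquiv F (Fin n → F)).symm g.1).isUnit.map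
      LinearMap.toMatrixAlgEquiv'
  · rw [h, Matrix.toLin'_toMatrix']
    exact g.2
  · intro g g' hg
    exact Subtype.ext (LinearEquiv.toLinearMap_injective
      (LinearMap.toMatrix'.injective (congrArg Subtype.val hg)))
  · rintro ⟨A, hA, hA'⟩
    have hA₀ : IsUnit (Matrix.toLin' A) := hA.map Matrix.toLinAlgEquiv'
    refine ⟨⟨LinearMap.GeneralLinearGroup.generalLinearEquiv F (Fin n → F) hA₀.unit, ?_⟩, ?_⟩
    · rw [LinearMap.GeneralLinearGroup.generalLinearEquiv_to_linearMap]
      exact (h A).1 hA'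
    · refine Subtype.ext ?_
      simp

theorem card_linearEquiv_eq_gam (F : Type) [Field F] [Fintype F] (n : ℕ) :
    Nat.card ((Fin n → F) ≃ₗ[F] (Fin n → F)) = gam (Fintype.card F) n := by
  rw [gam, Finset.prod_range, ← Matrix.card_GL_field]
  exact Nat.card_congr (Matrix.GeneralLinearGroup.toLin.trans
    (LinearMap.GeneralLinearGroup.generalLinearEquiv F (Fin n → F))).symm.toEquiv

theorem linDerCount_div_card_GL_eq_sum {F : Type} [Field F] [Fintype F] (q : ℕ)
    (hq : Fintype.card F = q) (n : ℕ) :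
    (linDerCount F n : ℚ) / (gam q n : ℚ)
      = 1 + ∑ i ∈ Finset.Icc 1 n,
          (-1 : ℚ) ^ i / ∏ j ∈ Finset.Icc 1 i, ((q : ℚ) ^ j - 1) := by
  classical
  subst hq
  set V := Fin n → F
  have : Finite (V ≃ₗ[F] V) := Finite.of_injective _ DFunLike.coe_injective
  have : Fintype (V ≃ₗ[F] V) := Fintype.ofFinite _
  have hq : (1 : ℚ) < Fintype.card F := by exact_mod_cast Fintype.one_lt_card
  have hV : finrank F V = n := by simp [V]
  have hgam : (gam (Fintype.card F) n : ℚ) ≠ 0 := by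
    rw [← card_linearEquiv_eq_gam]
    exact_mod_cast Nat.card_pos.ne'
  have hder : (linDerCount F n : ℚ) = ∑ g : V ≃ₗ[F] V,
      if finrank F (LinearMap.ker ((g : V →ₗ[F] V) - 1)) = 0 then 1 else 0 := by
    rw [linDerCount_eq_card_linearEquiv, Finset.sum_boole, Nat.card_eq_fintype_card,
      Fintype.card_subtype]
  have hrange : 1 + ∑ i ∈ Finset.Icc 1 n,
      (-1 : ℚ) ^ i / ∏ j ∈ Finset.Icc 1 i, ((Fintype.card F : ℚ) ^ j - 1) =
      ∑ i ∈ Finset.range (n + 1),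
        (-1 : ℚ) ^ i / ∏ j ∈ Finset.Icc 1 i, ((Fintype.card F : ℚ) ^ j - 1) := by
    rw [Finset.sum_range_succ', add_comm, ← Finset.Ico_add_one_right_eq_Icc,
      Finset.sum_Ico_eq_sum_range, Nat.add_sub_cancel]
    simp [add_comm]
  rw [hrange, div_eq_iff hgam, hder, Finset.sum_mul]
  have hker (g : V ≃ₗ[F] V) : finrank F (LinearMap.ker ((g : V →ₗ[F] V) - 1)) ≤ n :=
    (Submodule.finrank_le _).trans hV.le
  rw [Finset.sum_congr rfl fun g _ ↦
    (sum_range_neg_one_pow_div_mul_prod_pow_sub (Fintype.card F : ℚ) hq (hker g)).symm,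
    Finset.sum_comm]
  refine Finset.sum_congr rfl fun k hk ↦ ?_
  rw [← Finset.mul_sum, sum_prod_card_pow_finrank_ker_sub
    (by rw [hV]; exact Finset.mem_range_succ_iff.1 hk), card_linearEquiv_eq_gam]
end

section
/- Let d_n denote the number of projective derangements among n×n matrices over 𝔽_q. Then the sequence d_n/γ_n converges as n → ∞, and lim_{n→∞} d_n/γ_n = ∏_{r≥1} (1 − q^{−r})^{q−1} (an infinite product of real numbers raised to the power q − 1). -/
/-- The number of `n × n` projective derangements over the field `F`, i.e. matrices `A`
having no eigenvalue in `F`: `A - a • 1` is invertible for every `a ∈ F`. -/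
noncomputable def projDerCount (F : Type) [Field F] [Fintype F] (n : ℕ) : ℕ :=
  Nat.card {A : Matrix (Fin n) (Fin n) F // ∀ a : F, IsUnit (A - a • (1 : Matrix (Fin n) (Fin n) F))}

theorem summable_norm_coeff_of_q_recurrence {x : ℝ} (hx0 : 0 ≤ x) (hx1 : x < 1) {c : ℕ → ℝ}
    (hc : ∀ n, c (n + 1) = x ^ (n + 1) * (c (n + 1) - c n)) : Summable fun n => ‖c n‖ := by
  refine (summable_of_ratio_norm_eventually_le (f := fun n => ‖c n‖) (r := 1 / 2)
    (by norm_num) ?_)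
  have ht : Filter.Tendsto (fun n : ℕ => x ^ (n + 1)) Filter.atTop (nhds 0) :=
    (tendsto_pow_atTop_nhds_zero_of_lt_one hx0 hx1).comp (Filter.tendsto_add_atTop_nat 1)
  filter_upwards [ht.eventually (ge_mem_nhds (show (0 : ℝ) < 1 / 3 by norm_num))] with n hn
  have h0 : 0 ≤ x ^ (n + 1) := pow_nonneg hx0 _
  have h : |c (n + 1)| ≤ x ^ (n + 1) * (|c (n + 1)| + |c n|) := by
    conv_lhs => rw [hc n, abs_mul, abs_of_nonneg h0]
    exact mul_le_mul_of_nonneg_left (abs_sub _ _) h0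
  simp only [Real.norm_eq_abs, abs_abs]
  nlinarith [abs_nonneg (c n), abs_nonneg (c (n + 1))]

/-- Euler's identity, for the coefficients of `∏ (1 - u x ^ (r + 1))` evaluated at `u = 1`. -/
theorem tsum_eq_tprod_of_q_recurrence {x : ℝ} (hx0 : 0 ≤ x) (hx1 : x < 1) {c : ℕ → ℝ}
    (hc0 : c 0 = 1) (hc : ∀ n, c (n + 1) = x ^ (n + 1) * (c (n + 1) - c n)) :
    ∑' n, c n = ∏' r : ℕ, (1 - x ^ (r + 1)) := by
  have hs := summable_norm_coeff_of_q_recurrence hx0 hx1 hc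
  have hbound : ∀ k n, ‖c n * (x ^ k) ^ n‖ ≤ ‖c n‖ := fun k n => by
    rw [norm_mul, norm_pow, norm_pow]
    refine mul_le_of_le_one_right (norm_nonneg _) (pow_le_one₀ (by positivity) ?_)
    exact pow_le_one₀ (norm_nonneg _) (by rw [Real.norm_of_nonneg hx0]; exact hx1.le)
  have hsk : ∀ k, Summable fun n => c n * (x ^ k) ^ n := fun k =>
    Summable.of_norm_bounded hs (hbound k)
  have hstep : ∀ k, ∑' n, c n * (x ^ k) ^ n =
      (1 - x ^ (k + 1)) * ∑' n, c n * (x ^ (k + 1)) ^ n := fun k => by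
    have h1 : ∀ n, c (n + 1) * (x ^ k) ^ (n + 1) =
        c (n + 1) * (x ^ (k + 1)) ^ (n + 1) - x ^ (k + 1) * (c n * (x ^ (k + 1)) ^ n) := fun n => by
      conv_lhs => rw [hc n]
      ring
    have h2 := (hsk (k + 1)).tsum_eq_zero_add
    rw [(hsk k).tsum_eq_zero_add]
    simp_rw [h1]
    rw [((summable_nat_add_iff 1).2 (hsk (k + 1))).tsum_sub ((hsk (k + 1)).mul_left _),
      tsum_mul_left]
    linear_combination -h2
  have hprod : ∀ k, ∑' n, c n =
      (∏ r ∈ Finset.range k, (1 - x ^ (r + 1))) * ∑' n, c n * (x ^ k) ^ n := fun k => by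
    induction k with
    | zero => simp
    | succ k ih => rw [ih, hstep, Finset.prod_range_succ, mul_assoc]
  have hlim : Filter.Tendsto (fun k => ∑' n, c n * (x ^ k) ^ n) Filter.atTop (nhds 1) := by
    have h := tendsto_tsum_of_dominated_convergence (𝓕 := Filter.atTop)
      (f := fun k n => c n * (x ^ k) ^ n) (g := fun n => c n * 0 ^ n) hs
      (fun n => ((tendsto_pow_atTop_nhds_zero_of_lt_one hx0 hx1).pow n).const_mul _)
      (Filter.Eventually.of_forall hbound)
    rwa [tsum_eq_single 0 (fun n hn => by simp [hn]), pow_zero, mul_one, hc0] at h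
  have hm : Multipliable fun r : ℕ => 1 - x ^ (r + 1) := by
    simp_rw [sub_eq_add_neg]
    exact Real.multipliable_one_add_of_summable
      ((summable_nat_add_iff 1).2 (summable_geometric_of_lt_one hx0 hx1)).neg
  have h := hm.hasProd.tendsto_prod_nat.mul hlim
  rw [mul_one] at h
  exact tendsto_nhds_unique (tendsto_const_nhds.congr hprod) h

namespace PowerSeries

theorem summable_norm_coeff_pow_and_tsum {P : ℝ⟦X⟧} (hP : Summable fun n => ‖coeff n P‖) (m : ℕ) :
    (Summable fun n => ‖coeff n (P ^ m)‖) ∧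
      ∑' n, coeff n (P ^ m) = (∑' n, coeff n P) ^ m := by
  induction m with
  | zero =>
    have h : ∀ n, n ∉ ({0} : Finset ℕ) → coeff n (1 : ℝ⟦X⟧) = 0 := fun n hn => by
      simpa [coeff_one] using hn
    refine ⟨summable_of_ne_finset_zero (s := {0}) fun n hn => ?_, ?_⟩
    · rw [pow_zero, h n hn, norm_zero]
    · rw [pow_zero, pow_zero, tsum_eq_sum h]
      simp
  | succ m ih =>
    simp only [pow_succ, coeff_mul]
    have h := tsum_mul_tsum_eq_tsum_sum_antidiagonal_of_summable_norm
      (f := fun n => coeff n (P ^ m)) (g := fun n => coeff n P) ih.1 hP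
    exact ⟨summable_norm_sum_mul_antidiagonal_of_summable_norm
      (f := fun n => coeff n (P ^ m)) (g := fun n => coeff n P) ih.1 hP, by rw [← h, ih.2]⟩

/-- The recurrence satisfied by the coefficients of the inverse of `(1 - X) * M`, where
`M = ∑ X ^ n / ((1 - x) ⋯ (1 - x ^ n))` up to a scalar. -/
theorem coeff_recurrence_of_mul_eq_one {x : ℝ} {M P : ℝ⟦X⟧}
    (hM : ∀ n, coeff (n + 1) M * (1 - x ^ (n + 1)) = coeff n M) (hP : P * ((1 - X) * M) = 1)
    (n : ℕ) :
    coeff (n + 1) P = x ^ (n + 1) * (coeff (n + 1) P - coeff n P) := by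
  have h1 : (1 - X) * M = rescale x M := by
    ext n
    rw [sub_mul, one_mul, map_sub, coeff_rescale]
    cases n with
    | zero => simp
    | succ n => rw [coeff_succ_X_mul, ← hM n]; ring
  rw [h1] at hP
  have h2 : rescale x P * rescale x ((1 - X) * M) = 1 := by
    rw [h1, ← map_mul, hP, map_one]
  have h3 : P = (1 - C x * X) * rescale x P := by
    rw [map_mul, map_sub, map_one, rescale_X] at h2
    calc P = P * (rescale x P * ((1 - C x * X) * rescale x M)) := by rw [h2, mul_one]
      _ = (P * rescale x M) * ((1 - C x * X) * rescale x P) := by ring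
      _ = _ := by rw [hP, one_mul]
  conv_lhs => rw [h3]
  rw [sub_mul, one_mul, map_sub, mul_assoc, coeff_C_mul, coeff_succ_X_mul, coeff_rescale,
    coeff_rescale]
  ring

/-- The coefficients of `P ^ m / (1 - X)` converge to the value of `P ^ m` at `1`. -/
theorem tendsto_coeff_pow_mul_mk_one {P : ℝ⟦X⟧} (hP : Summable fun n => ‖coeff n P‖) (m : ℕ) :
    Filter.Tendsto (fun n => coeff n (P ^ m * mk 1)) Filter.atTop
      (nhds ((∑' n, coeff n P) ^ m)) := by
  obtain ⟨hs, ht⟩ := summable_norm_coeff_pow_and_tsum hP m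
  rw [← ht]
  refine (hs.of_norm.hasSum.tendsto_sum_nat.comp (Filter.tendsto_add_atTop_nat 1)).congr fun n => ?_
  simp [coeff_mul, Finset.Nat.sum_antidiagonal_eq_sum_range_succ_mk]

end PowerSeries

open Module

section Fitting

variable {F V K L : Type*} [Field F] [AddCommGroup V] [Module F V] [AddCommGroup K] [Module F K]
  [AddCommGroup L] [Module F L]

theorem Module.End.mem_iSup_ker_pow {f : End F V} {x : V} :
    x ∈ ⨆ n, LinearMap.ker (f ^ n) ↔ ∃ n, (f ^ n) x = 0 := by
  rw [Submodule.mem_iSup_of_directed]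
  · rfl
  · exact (LinearMap.iterateKer f).monotone.directed_le

theorem LinearMap.prodMap_pow_apply (B : End F K) (C : End F L) (n : ℕ) (p : K × L) :
    ((B.prodMap C : End F (K × L)) ^ n) p = ((B ^ n) p.1, (C ^ n) p.2) := by
  induction n generalizing p with
  | zero => rfl
  | succ n ih => simp [pow_succ, ih]

theorem LinearEquiv.conj_pow_apply (e : K ≃ₗ[F] V) (g : End F K) (n : ℕ) (x : V) :
    ((e.conj g) ^ n) x = e ((g ^ n) (e.symm x)) := by
  induction n generalizing x with
  | zero => simp
  | succ n ih => rw [pow_succ, Module.End.mul_apply, ih]; simp [pow_succ, LinearEquiv.conj_apply]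

theorem mem_iSup_ker_pow_conj_prodMap (e : (K × L) ≃ₗ[F] V) {B : End F K} {C : End F L}
    (hB : IsNilpotent B) (hC : IsUnit C) (x : V) :
    x ∈ ⨆ n, LinearMap.ker (e.conj (B.prodMap C) ^ n) ↔ (e.symm x).2 = 0 := by
  rw [Module.End.mem_iSup_ker_pow]
  simp only [LinearEquiv.conj_pow_apply, LinearMap.prodMap_pow_apply, EmbeddingLike.map_eq_zero_iff,
    Prod.mk_eq_zero]
  constructor
  · rintro ⟨n, -, hn⟩
    have h := ((Module.End.isUnit_iff _).1 (hC.pow n)).1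
    exact h (by rw [hn, map_zero])
  · intro h
    obtain ⟨n, hn⟩ := hB
    exact ⟨n, by simp [hn], by simp [h]⟩

theorem mem_iInf_range_pow_conj_prodMap (e : (K × L) ≃ₗ[F] V) {B : End F K} {C : End F L}
    (hB : IsNilpotent B) (hC : IsUnit C) (x : V) :
    x ∈ ⨅ n, LinearMap.range (e.conj (B.prodMap C) ^ n) ↔ (e.symm x).1 = 0 := by
  simp only [Submodule.mem_iInf, LinearMap.mem_range, LinearEquiv.conj_pow_apply,
    LinearMap.prodMap_pow_apply]
  constructor
  · intro h
    obtain ⟨n, hn⟩ := hB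
    obtain ⟨y, rfl⟩ := h n
    simp [hn]
  · intro h n
    obtain ⟨y, hy⟩ := ((Module.End.isUnit_iff _).1 (hC.pow n)).2 (e.symm x).2
    refine ⟨e (0, y), e.symm.injective ?_⟩
    ext <;> simp [h, hy]

theorem finrank_iSup_ker_pow_conj_prodMap (e : (K × L) ≃ₗ[F] V) {B : End F K} {C : End F L}
    (hB : IsNilpotent B) (hC : IsUnit C) :
    finrank F ↥(⨆ n, LinearMap.ker (e.conj (B.prodMap C) ^ n)) = finrank F K := by
  have h : (⨆ n, LinearMap.ker (e.conj (B.prodMap C) ^ n)) =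
      LinearMap.range (e.toLinearMap ∘ₗ LinearMap.inl F K L) := by
    ext x
    rw [mem_iSup_ker_pow_conj_prodMap e hB hC]
    constructor
    · intro h
      refine ⟨(e.symm x).1, e.symm.injective ?_⟩
      ext <;> simp [h]
    · rintro ⟨y, rfl⟩
      simp
  rw [h, LinearMap.finrank_range_of_inj]
  exact e.injective.comp LinearMap.inl_injective

/-- The endomorphisms having no eigenvalue in `S`. -/
def Module.End.noEigenvalueIn (F V : Type*) [Field F] [AddCommGroup V] [Module F V] (S : Set F) :
    Set (End F V) :=
  {f | ∀ s ∈ S, IsUnit (f - s • 1)}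

theorem LinearMap.isUnit_prodMap_iff {B : End F K} {C : End F L} :
    IsUnit (B.prodMap C : End F (K × L)) ↔ IsUnit B ∧ IsUnit C := by
  rw [Module.End.isUnit_iff, Module.End.isUnit_iff, Module.End.isUnit_iff, LinearMap.coe_prodMap]
  exact Prod.map_bijective

theorem LinearEquiv.isUnit_conj_iff (e : K ≃ₗ[F] V) {g : End F K} :
    IsUnit (e.conj g) ↔ IsUnit g :=
  MulEquiv.isUnit_map e.conjRingEquiv

theorem LinearEquiv.conj_sub_smul_one (e : K ≃ₗ[F] V) (g : End F K) (s : F) :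
    e.conj g - s • 1 = e.conj (g - s • 1) := by
  ext x
  simp [LinearEquiv.conj_apply]

theorem conj_prodMap_mem_noEigenvalueIn_iff (e : (K × L) ≃ₗ[F] V) {B : End F K} {C : End F L}
    {S : Set F} (hS : (0 : F) ∉ S) (hB : IsNilpotent B) :
    e.conj (B.prodMap C) ∈ Module.End.noEigenvalueIn F V S ↔
      C ∈ Module.End.noEigenvalueIn F L S := by
  refine forall₂_congr fun s hs => ?_
  have h : (B.prodMap C : End F (K × L)) - s • 1 = (B - s • 1).prodMap (C - s • 1) := by
    ext <;> simp
  rw [LinearEquiv.conj_sub_smul_one, LinearEquiv.isUnit_conj_iff, h, LinearMap.isUnit_prodMap_iff,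
    and_iff_right]
  have hs0 : s ≠ 0 := fun h => hS (h ▸ hs)
  have hu : IsUnit (-(s • (1 : End F K))) :=
    ((isUnit_one.smul (Units.mk0 s hs0))).neg
  rw [sub_eq_neg_add]
  exact hB.isUnit_add_left_of_commute hu (((Commute.one_right B).smul_right s).neg_right)

/-- Fitting's decomposition, in coordinates. -/
theorem exists_conj_prodMap_eq [FiniteDimensional F V] [FiniteDimensional F K]
    [FiniteDimensional F L] (hdim : finrank F K + finrank F L = finrank F V) (f : End F V)
    (hf : finrank F ↥(⨆ n, LinearMap.ker (f ^ n)) = finrank F K) :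
    ∃ (e : (K × L) ≃ₗ[F] V) (B : End F K) (C : End F L),
      IsNilpotent B ∧ IsUnit C ∧ e.conj (B.prodMap C) = f := by
  have hc := LinearMap.isCompl_iSup_ker_pow_iInf_range_pow f
  set U := ⨆ n, LinearMap.ker (f ^ n) with hU
  set W := ⨅ n, LinearMap.range (f ^ n) with hW
  have hfU : ∀ x ∈ U, f x ∈ U := fun x hx => by
    obtain ⟨n, hn⟩ := Module.End.mem_iSup_ker_pow.1 hx
    exact Module.End.mem_iSup_ker_pow.2
      ⟨n, by rw [← Module.End.mul_apply, ← pow_succ, pow_succ', Module.End.mul_apply, hn, map_zero]⟩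
  have hfW : ∀ x ∈ W, f x ∈ W := fun x hx => by
    rw [hW, Submodule.mem_iInf] at hx ⊢
    intro n
    obtain ⟨y, rfl⟩ := hx n
    exact ⟨f y, by rw [← Module.End.mul_apply, ← pow_succ, pow_succ', Module.End.mul_apply]⟩
  have hWdim : finrank F L = finrank F W := by
    have := Submodule.finrank_add_eq_of_isCompl hc
    omega
  let k : K ≃ₗ[F] U := LinearEquiv.ofFinrankEq _ _ hf.symm
  let l : L ≃ₗ[F] W := LinearEquiv.ofFinrankEq _ _ hWdim
  refine ⟨(k.prodCongr l).trans (Submodule.prodEquivOfIsCompl U W hc),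
    k.symm.conj (f.restrict hfU), l.symm.conj (f.restrict hfW), ?_, ?_, ?_⟩
  · refine IsNilpotent.map (f := k.symm.conjRingEquiv) ?_
    obtain ⟨n, hn⟩ := f.eventually_iSup_ker_pow_eq.exists
    refine ⟨n, LinearMap.ext fun x => Subtype.ext ?_⟩
    rw [Module.End.pow_restrict n hfU]
    have hx : (x : V) ∈ LinearMap.ker (f ^ n) := hn ▸ x.2
    exact hx
  · rw [LinearEquiv.isUnit_conj_iff, LinearMap.isUnit_iff_ker_eq_bot, LinearMap.ker_eq_bot']
    intro x hx
    have hx' : f x = 0 := congrArg Subtype.val hx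
    refine Subtype.ext (Submodule.disjoint_def.1 hc.disjoint _ ?_ x.2)
    exact Module.End.mem_iSup_ker_pow.2 ⟨1, by rwa [pow_one]⟩
  · refine LinearMap.ext fun x => ?_
    obtain ⟨p, rfl⟩ := ((k.prodCongr l).trans (Submodule.prodEquivOfIsCompl U W hc)).surjective x
    simp [LinearEquiv.conj_apply]

theorem LinearEquiv.exists_eq_prodCongr [FiniteDimensional F K] [FiniteDimensional F L]
    (g : (K × L) ≃ₗ[F] K × L) (h1 : ∀ p, (g p).1 = 0 ↔ p.1 = 0) (h2 : ∀ p, (g p).2 = 0 ↔ p.2 = 0) :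
    ∃ (g₁ : K ≃ₗ[F] K) (g₂ : L ≃ₗ[F] L), g = g₁.prodCongr g₂ := by
  let a : K →ₗ[F] K := LinearMap.fst F K L ∘ₗ g.toLinearMap ∘ₗ LinearMap.inl F K L
  let b : L →ₗ[F] L := LinearMap.snd F K L ∘ₗ g.toLinearMap ∘ₗ LinearMap.inr F K L
  have ha : Function.Injective a := (injective_iff_map_eq_zero a).2 fun x hx => (h1 (x, 0)).1 hx
  have hb : Function.Injective b := (injective_iff_map_eq_zero b).2 fun x hx => (h2 (0, x)).1 hx
  refine ⟨LinearEquiv.ofInjectiveEndo a ha, LinearEquiv.ofInjectiveEndo b hb, ?_⟩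
  have ha' : ∀ x, g (x, 0) = (a x, 0) := fun x => Prod.ext rfl ((h2 _).2 rfl)
  have hb' : ∀ x, g (0, x) = (0, b x) := fun x => Prod.ext ((h1 _).2 rfl) rfl
  refine LinearEquiv.ext fun p => ?_
  have hp : p = (p.1, 0) + (0, p.2) := by simp
  conv_lhs => rw [hp, map_add, ha', hb']
  simp

theorem card_conj_prodMap_fiber [FiniteDimensional F K] [FiniteDimensional F L]
    {S : Set F} (hS : (0 : F) ∈ S) (e₀ : (K × L) ≃ₗ[F] V)
    {B₀ : End F K} {C₀ : End F L} (hB₀ : IsNilpotent B₀)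
    (hC₀ : C₀ ∈ Module.End.noEigenvalueIn F L S) :
    Nat.card {t : ((K × L) ≃ₗ[F] V) × {B : End F K // IsNilpotent B} ×
        Module.End.noEigenvalueIn F L S //
      t.1.conj (t.2.1.1.prodMap t.2.2.1) = e₀.conj (B₀.prodMap C₀)} =
    Nat.card (K ≃ₗ[F] K) * Nat.card (L ≃ₗ[F] L) := by
  have hunit : ∀ C ∈ Module.End.noEigenvalueIn F L S, IsUnit C := fun C hC => by
    simpa using hC 0 hS
  rw [← Nat.card_prod]
  symm
  refine Nat.card_congr (Equiv.ofBijective (fun g =>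
    ⟨((g.1.prodCongr g.2).trans e₀, ⟨g.1.symm.conj B₀, hB₀.map g.1.symm.conjRingEquiv⟩,
      ⟨g.2.symm.conj C₀, fun s hs => ?_⟩), ?_⟩) ⟨?_, ?_⟩)
  · rw [LinearEquiv.conj_sub_smul_one, LinearEquiv.isUnit_conj_iff]
    exact hC₀ s hs
  · ext x
    simp [LinearEquiv.conj_apply]
  · rintro ⟨g₁, g₂⟩ ⟨g₁', g₂'⟩ h
    have h' : ∀ p : K × L, (g₁ p.1, g₂ p.2) = (g₁' p.1, g₂' p.2) := fun p =>
      e₀.injective (LinearEquiv.congr_fun (congrArg (fun t => t.1.1) h) p)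
    refine Prod.ext (LinearEquiv.ext fun x => ?_) (LinearEquiv.ext fun x => ?_)
    · exact congrArg Prod.fst (h' (x, 0))
    · exact congrArg Prod.snd (h' (0, x))
  · rintro ⟨⟨e, ⟨B, hB⟩, ⟨C, hC⟩⟩, h⟩
    dsimp only at h
    obtain ⟨g₁, g₂, hg⟩ := LinearEquiv.exists_eq_prodCongr (e.trans e₀.symm)
      (fun p => by
        have h1 := mem_iInf_range_pow_conj_prodMap e hB (hunit C hC) (e p)
        rw [h, mem_iInf_range_pow_conj_prodMap e₀ hB₀ (hunit C₀ hC₀)] at h1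
        simpa using h1)
      (fun p => by
        have h1 := mem_iSup_ker_pow_conj_prodMap e hB (hunit C hC) (e p)
        rw [h, mem_iSup_ker_pow_conj_prodMap e₀ hB₀ (hunit C₀ hC₀)] at h1
        simpa using h1)
    have he : e = (g₁.prodCongr g₂).trans e₀ := by
      rw [← hg]
      ext x
      simp
    subst he
    have hBC : ∀ p : K × L, (g₁ (B p.1), g₂ (C p.2)) = (B₀ (g₁ p.1), C₀ (g₂ p.2)) := fun p => by
      have := LinearMap.congr_fun h (e₀ (g₁ p.1, g₂ p.2))
      simpa [LinearEquiv.conj_apply] using this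
    refine ⟨(g₁, g₂), Subtype.ext (Prod.ext rfl (Prod.ext (Subtype.ext ?_) (Subtype.ext ?_)))⟩
    · ext x
      have := congrArg Prod.fst (hBC (x, 0))
      simpa [LinearEquiv.conj_apply, LinearEquiv.symm_apply_eq] using this.symm
    · ext x
      have := congrArg Prod.snd (hBC (0, x))
      simpa [LinearEquiv.conj_apply, LinearEquiv.symm_apply_eq] using this.symm

theorem card_noEigenvalueIn_finrank_eq_mul [Finite F] [FiniteDimensional F V]
    [FiniteDimensional F K] [FiniteDimensional F L]
    (hdim : finrank F K + finrank F L = finrank F V) {S : Set F} (hS : (0 : F) ∉ S) :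
    Nat.card {f : End F V // f ∈ Module.End.noEigenvalueIn F V S ∧
        finrank F ↥(⨆ n, LinearMap.ker (f ^ n)) = finrank F K} *
      (Nat.card (K ≃ₗ[F] K) * Nat.card (L ≃ₗ[F] L)) =
    Nat.card (V ≃ₗ[F] V) * (Nat.card {B : End F K // IsNilpotent B} *
      Nat.card (Module.End.noEigenvalueIn F L (insert 0 S))) := by
  have : Finite V := Module.finite_of_finite F
  have : Finite K := Module.finite_of_finite F
  have : Finite L := Module.finite_of_finite F
  have hfV : Finite (End F V) := DFunLike.finite _
  have hfK : Finite (End F K) := DFunLike.finite _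
  have hfL : Finite (End F L) := DFunLike.finite _
  have hmem : ∀ C : End F L, C ∈ Module.End.noEigenvalueIn F L (insert 0 S) ↔
      IsUnit C ∧ C ∈ Module.End.noEigenvalueIn F L S := fun C => by
    simp [Module.End.noEigenvalueIn]
  have e₁ : (K × L) ≃ₗ[F] V := LinearEquiv.ofFinrankEq _ _ (by rw [finrank_prod, hdim])
  have hcard : Nat.card (V ≃ₗ[F] V) = Nat.card ((K × L) ≃ₗ[F] V) :=
    Nat.card_congr ⟨fun g => e₁.trans g, fun e => e₁.symm.trans e,
      fun g => by ext; simp, fun g => by ext : 1; simp⟩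
  let X := {f : End F V // f ∈ Module.End.noEigenvalueIn F V S ∧
        finrank F ↥(⨆ n, LinearMap.ker (f ^ n)) = finrank F K}
  let T := ((K × L) ≃ₗ[F] V) × {B : End F K // IsNilpotent B} ×
        Module.End.noEigenvalueIn F L (insert 0 S)
  let Φ : T → X := fun t => ⟨t.1.conj (t.2.1.1.prodMap t.2.2.1),
    (conj_prodMap_mem_noEigenvalueIn_iff t.1 hS t.2.1.2).2 ((hmem _).1 t.2.2.2).2,
    finrank_iSup_ker_pow_conj_prodMap t.1 t.2.1.2 ((hmem _).1 t.2.2.2).1⟩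
  have hfT : Finite T := by
    have : Finite ((K × L) ≃ₗ[F] V) := DFunLike.finite _
    exact inferInstance
  have hfib : ∀ f : X, Nat.card {t : T // Φ t = f} =
      Nat.card (K ≃ₗ[F] K) * Nat.card (L ≃ₗ[F] L) := by
    rintro ⟨f, hfS, hf⟩
    obtain ⟨e₀, B₀, C₀, hB₀, hC₀, rfl⟩ := exists_conj_prodMap_eq hdim f hf
    rw [← card_conj_prodMap_fiber (Set.mem_insert 0 S) e₀ hB₀
      ((hmem _).2 ⟨hC₀, (conj_prodMap_mem_noEigenvalueIn_iff e₀ hS hB₀).1 hfS⟩)]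
    exact Nat.card_congr (Equiv.subtypeEquivRight fun t => Subtype.ext_iff)
  have := Fintype.ofFinite X
  rw [hcard, ← Nat.card_prod {B : End F K // IsNilpotent B}, ← Nat.card_prod ((K × L) ≃ₗ[F] V),
    ← Nat.card_congr (Equiv.sigmaFiberEquiv Φ), Nat.card_sigma]
  simp_rw [hfib]
  rw [Finset.sum_const, Finset.card_univ, ← Nat.card_eq_fintype_card, smul_eq_mul]

theorem card_noEigenvalueIn_preimage_add (S : Set F) (a : F) :
    Nat.card (Module.End.noEigenvalueIn F V ((· + a) ⁻¹' S)) =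
      Nat.card (Module.End.noEigenvalueIn F V S) := by
  refine Nat.card_congr ((Equiv.addRight (a • (1 : End F V))).subtypeEquiv fun f => ?_)
  simp only [Module.End.noEigenvalueIn, Set.mem_ofPred_eq, Set.mem_preimage, Equiv.coe_addRight]
  constructor
  · intro h s hs
    have := h (s - a) (by simpa using hs)
    rwa [sub_smul, ← sub_add, sub_add_eq_add_sub] at this
  · intro h s hs
    have := h (s + a) hs
    rwa [add_smul, add_sub_add_right_eq_sub] at this

end Fitting

section Counting

variable (F : Type) [Field F] [Fintype F]

theorem card_linearEquiv_fin_fun (n : ℕ) :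
    Nat.card ((Fin n → F) ≃ₗ[F] (Fin n → F)) = gam (Fintype.card F) n := by
  rw [gam, ← Fin.prod_univ_eq_prod_range (fun i => Fintype.card F ^ n - Fintype.card F ^ i),
    ← Matrix.card_GL_field]
  exact Nat.card_congr (Matrix.GeneralLinearGroup.toLin.trans
    (LinearMap.GeneralLinearGroup.generalLinearEquiv F (Fin n → F))).toEquiv.symm

theorem gam_card_pos (n : ℕ) : 0 < gam (Fintype.card F) n := by
  refine Finset.prod_pos fun i hi => ?_
  exact Nat.sub_pos_of_lt (Nat.pow_lt_pow_right Fintype.one_lt_card (Finset.mem_range.1 hi))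

open PowerSeries in
/-- `∑ c n / |GL_n| u ^ n`, where `c n` counts the `n × n` matrices with no eigenvalue in `S`. -/
noncomputable def noEigenvalueInSeries (S : Set F) : ℝ⟦X⟧ :=
  mk fun n => (Nat.card (Module.End.noEigenvalueIn F (Fin n → F) S) : ℝ) / gam (Fintype.card F) n

open PowerSeries in
/-- `∑ c n / |GL_n| u ^ n`, where `c n` counts the nilpotent `n × n` matrices. -/
noncomputable def nilpotentSeries : ℝ⟦X⟧ :=
  mk fun n => (Nat.card {B : End F (Fin n → F) // IsNilpotent B} : ℝ) / gam (Fintype.card F) n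

theorem card_noEigenvalueIn_eq_sum {V : Type*} [AddCommGroup V] [Module F V]
    [FiniteDimensional F V] (S : Set F) :
    Nat.card (Module.End.noEigenvalueIn F V S) =
      ∑ k ∈ Finset.range (finrank F V + 1),
        Nat.card {f : End F V // f ∈ Module.End.noEigenvalueIn F V S ∧
          finrank F ↥(⨆ n, LinearMap.ker (f ^ n)) = k} := by
  classical
  have : Finite V := Module.finite_of_finite F
  have hfV : Finite (End F V) := DFunLike.finite _
  have := Fintype.ofFinite (End F V)
  simp only [Nat.card_eq_fintype_card, Fintype.card_subtype]
  rw [Finset.card_eq_sum_card_fiberwise (t := Finset.range (finrank F V + 1))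
    (f := fun f : End F V => finrank F ↥(⨆ n, LinearMap.ker (f ^ n)))]
  · simp only [Finset.filter_filter]
  · intro f _
    simpa [Nat.lt_succ_iff] using Submodule.finrank_le _

theorem noEigenvalueInSeries_eq_mul_insert_zero {S : Set F} (hS : (0 : F) ∉ S) :
    noEigenvalueInSeries F S = nilpotentSeries F * noEigenvalueInSeries F (insert 0 S) := by
  have hγ : ∀ n, (gam (Fintype.card F) n : ℝ) ≠ 0 := fun n =>
    Nat.cast_ne_zero.2 (gam_card_pos F n).ne'
  ext n
  rw [PowerSeries.coeff_mul, noEigenvalueInSeries, PowerSeries.coeff_mk,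
    card_noEigenvalueIn_eq_sum, Module.finrank_fin_fun, Nat.cast_sum, Finset.sum_div,
    Finset.Nat.sum_antidiagonal_eq_sum_range_succ_mk]
  refine Finset.sum_congr rfl fun k hk => ?_
  have hkn : k + (n - k) = n := Nat.add_sub_of_le (Nat.lt_succ_iff.1 (Finset.mem_range.1 hk))
  have h := card_noEigenvalueIn_finrank_eq_mul (F := F) (V := Fin n → F) (K := Fin k → F)
    (L := Fin (n - k) → F) (by simpa using hkn) hS
  simp only [card_linearEquiv_fin_fun, Module.finrank_fin_fun] at h
  simp only [noEigenvalueInSeries, nilpotentSeries, PowerSeries.coeff_mk]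
  have h' := congrArg (Nat.cast : ℕ → ℝ) h
  push_cast at h'
  rw [div_mul_div_comm, div_eq_div_iff (hγ n) (mul_ne_zero (hγ k) (hγ _)), h']
  ring

theorem noEigenvalueInSeries_eq_mul_insert {S : Set F} {a : F} (ha : a ∉ S) :
    noEigenvalueInSeries F S = nilpotentSeries F * noEigenvalueInSeries F (insert a S) := by
  have hshift : ∀ T, noEigenvalueInSeries F ((· + a) ⁻¹' T) = noEigenvalueInSeries F T := fun T => by
    simp only [noEigenvalueInSeries, card_noEigenvalueIn_preimage_add]
  rw [← hshift S, ← hshift (insert a S), noEigenvalueInSeries_eq_mul_insert_zero F (by simpa)]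
  congr 2
  ext s
  simp

theorem noEigenvalueInSeries_empty_eq (T : Finset F) :
    noEigenvalueInSeries F ∅ = nilpotentSeries F ^ T.card * noEigenvalueInSeries F T := by
  classical
  induction T using Finset.induction_on with
  | empty => simp
  | insert a T ha ih =>
    rw [ih, Finset.card_insert_of_notMem ha, Finset.coe_insert, pow_succ, mul_assoc,
      ← noEigenvalueInSeries_eq_mul_insert F (by simpa using ha)]

theorem noEigenvalueInSeries_singleton_zero :
    noEigenvalueInSeries F {0} = PowerSeries.mk 1 := by
  ext n
  rw [noEigenvalueInSeries, PowerSeries.coeff_mk, PowerSeries.coeff_mk, ← card_linearEquiv_fin_fun]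
  have h : Nat.card (Module.End.noEigenvalueIn F (Fin n → F) {0}) =
      Nat.card ((Fin n → F) ≃ₗ[F] (Fin n → F)) := by
    rw [← Nat.card_congr (LinearMap.GeneralLinearGroup.generalLinearEquiv F (Fin n → F)).toEquiv]
    have hmem : ∀ f : End F (Fin n → F),
        f ∈ Module.End.noEigenvalueIn F (Fin n → F) {0} ↔ IsUnit f := fun f => by
      simp [Module.End.noEigenvalueIn]
    refine (Nat.card_congr (Equiv.ofBijective
      (fun u : (End F (Fin n → F))ˣ => (⟨u.1, (hmem _).2 u.isUnit⟩ :
        Module.End.noEigenvalueIn F (Fin n → F) {0})) ⟨?_, ?_⟩)).symm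
    · exact fun u v h => Units.ext (congrArg Subtype.val h)
    · rintro ⟨f, hf⟩
      exact ⟨((hmem f).1 hf).unit, rfl⟩
  rw [h, Pi.one_apply, div_self]
  rw [card_linearEquiv_fin_fun]
  exact Nat.cast_ne_zero.2 (gam_card_pos F n).ne'

theorem gam_succ (q n : ℕ) : gam q (n + 1) = (q ^ (n + 1) - 1) * (q ^ n * gam q n) := by
  have h : ∀ i, q ^ (n + 1) - q ^ (i + 1) = q * (q ^ n - q ^ i) := fun i => by
    rw [Nat.mul_sub, pow_succ', pow_succ']
  rw [gam, gam, Finset.prod_range_succ', mul_comm, pow_zero]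
  simp_rw [h]
  rw [Finset.prod_mul_distrib, Finset.prod_const, Finset.card_range]

theorem card_noEigenvalueIn_empty (n : ℕ) :
    Nat.card (Module.End.noEigenvalueIn F (Fin n → F) ∅) = Fintype.card F ^ (n * n) := by
  have h : Module.End.noEigenvalueIn F (Fin n → F) ∅ = Set.univ := by
    ext f
    simp [Module.End.noEigenvalueIn]
  rw [h, Nat.card_congr (Equiv.Set.univ _),
    ← Nat.card_congr (Matrix.toLin' (R := F) (m := Fin n) (n := Fin n)).toEquiv,
    Nat.card_eq_fintype_card]
  change Fintype.card (Fin n → Fin n → F) = _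
  simp [pow_mul]

theorem card_pow_div_gam_recurrence (n : ℕ) :
    (Fintype.card F ^ ((n + 1) * (n + 1)) : ℝ) / gam (Fintype.card F) (n + 1) *
      (1 - (Fintype.card F : ℝ)⁻¹ ^ (n + 1)) =
    (Fintype.card F ^ (n * n) : ℝ) / gam (Fintype.card F) n := by
  have hγ : (gam (Fintype.card F) n : ℝ) ≠ 0 := Nat.cast_ne_zero.2 (gam_card_pos F n).ne'
  have hq : (1 : ℝ) < Fintype.card F := by exact_mod_cast Fintype.one_lt_card
  have hq0 : (Fintype.card F : ℝ) ≠ 0 := by positivity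
  have hq1 : (Fintype.card F : ℝ) ^ (n + 1) - 1 ≠ 0 :=
    (sub_pos.2 (one_lt_pow₀ hq n.succ_ne_zero)).ne'
  rw [gam_succ]
  push_cast [Nat.one_le_pow (n + 1) _ (Fintype.card_pos (α := F))]
  rw [inv_pow]
  field_simp
  ring

theorem projDerCount_eq_card_noEigenvalueIn (n : ℕ) :
    projDerCount F n = Nat.card (Module.End.noEigenvalueIn F (Fin n → F) Set.univ) := by
  refine Nat.card_congr ((Matrix.toLinAlgEquiv' (R := F) (n := Fin n)).toEquiv.subtypeEquiv
    fun A => ?_)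
  simp only [Module.End.noEigenvalueIn, Set.mem_ofPred_eq, Set.mem_univ, forall_const]
  refine forall_congr' fun a => ?_
  rw [← MulEquiv.isUnit_map (Matrix.toLinAlgEquiv' (R := F) (n := Fin n))]
  rw [map_sub, map_smul, map_one]
  rfl

end Counting

theorem projDerCount_div_card_GL_tendsto {F : Type} [Field F] [Fintype F] (q : ℕ)
    (hq : Fintype.card F = q) :
    Filter.Tendsto (fun n : ℕ => (projDerCount F n : ℝ) / (gam q n : ℝ)) Filter.atTop
      (nhds ((∏' r : ℕ, (1 - ((q : ℝ))⁻¹ ^ (r + 1))) ^ (q - 1))) := by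
  subst hq
  have hq1 : (1 : ℝ) < Fintype.card F := by exact_mod_cast Fintype.one_lt_card
  have hx0 : (0 : ℝ) ≤ (Fintype.card F : ℝ)⁻¹ := by positivity
  have hx1 : (Fintype.card F : ℝ)⁻¹ < 1 := inv_lt_one_of_one_lt₀ hq1
  have hM : noEigenvalueInSeries F ∅ = nilpotentSeries F * PowerSeries.mk 1 := by
    have h := noEigenvalueInSeries_empty_eq F {0}
    rwa [Finset.card_singleton, pow_one, Finset.coe_singleton,
      noEigenvalueInSeries_singleton_zero] at h
  have hN : (1 - PowerSeries.X) * noEigenvalueInSeries F ∅ = nilpotentSeries F := by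
    rw [hM, mul_left_comm, mul_comm (1 - PowerSeries.X), PowerSeries.mk_one_mul_one_sub_eq_one,
      mul_one]
  have hcoeff : ∀ n, PowerSeries.coeff n (noEigenvalueInSeries F ∅) =
      (Fintype.card F ^ (n * n) : ℝ) / gam (Fintype.card F) n := fun n => by
    rw [noEigenvalueInSeries, PowerSeries.coeff_mk, card_noEigenvalueIn_empty, Nat.cast_pow]
  have h0 : PowerSeries.constantCoeff (nilpotentSeries F) = 1 := by
    rw [← hN, map_mul, ← PowerSeries.coeff_zero_eq_constantCoeff_apply (noEigenvalueInSeries F ∅),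
      hcoeff]
    simp [gam]
  obtain ⟨P, hPN⟩ : ∃ P, P * nilpotentSeries F = 1 :=
    ⟨_, PowerSeries.inv_mul_cancel _ (by rw [h0]; exact one_ne_zero)⟩
  have hc : ∀ n, PowerSeries.coeff (n + 1) P = (Fintype.card F : ℝ)⁻¹ ^ (n + 1) *
      (PowerSeries.coeff (n + 1) P - PowerSeries.coeff n P) := by
    refine PowerSeries.coeff_recurrence_of_mul_eq_one (fun n => ?_) (hN.symm ▸ hPN)
    rw [hcoeff, hcoeff]
    exact_mod_cast card_pow_div_gam_recurrence F n
  have hc0 : PowerSeries.coeff 0 P = 1 := by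
    have h := congrArg PowerSeries.constantCoeff hPN
    rwa [map_mul, h0, mul_one, map_one, ← PowerSeries.coeff_zero_eq_constantCoeff_apply] at h
  have hD : noEigenvalueInSeries F Set.univ = P ^ (Fintype.card F - 1) * PowerSeries.mk 1 := by
    have h := noEigenvalueInSeries_empty_eq F Finset.univ
    obtain ⟨m, hm⟩ : ∃ m, Fintype.card F = m + 1 := Nat.exists_eq_add_one.2 Fintype.card_pos
    rw [hM, Finset.card_univ, Finset.coe_univ, hm, pow_succ', mul_assoc] at h
    have h' := congrArg (P * ·) h
    simp only [← mul_assoc, hPN, one_mul] at h'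
    rw [h', hm, Nat.add_sub_cancel, ← mul_assoc, ← mul_pow, hPN, one_pow, one_mul]
  rw [← tsum_eq_tprod_of_q_recurrence (c := fun n => PowerSeries.coeff n P) hx0 hx1 hc0 hc]
  refine (PowerSeries.tendsto_coeff_pow_mul_mk_one
    (summable_norm_coeff_of_q_recurrence (c := fun n => PowerSeries.coeff n P) hx0 hx1 hc) _).congr
    fun n => ?_
  rw [← hD, projDerCount_eq_card_noEigenvalueIn]
  exact PowerSeries.coeff_mk _ _
end

section
/- The number d_n of diagonalizable n×n matrices over 𝔽_q equals the sum, over all functions m : 𝔽_q → ℕ with Σ_{a∈𝔽_q} m(a) = n, of γ_n / ∏_{a∈𝔽_q} γ_{m(a)} (each summand is a positive integer, being an index of a subgroup). -/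
/-- The number of diagonalizable `n × n` matrices over the field `F`. -/
noncomputable def diagCount (F : Type) [Field F] [Fintype F] (n : ℕ) : ℕ :=
  Nat.card {A : Matrix (Fin n) (Fin n) F //
    ∃ P : Matrix (Fin n) (Fin n) F, IsUnit P ∧
      ∃ d : Fin n → F, P⁻¹ * A * P = Matrix.diagonal d}

theorem card_units_matrix_eq_gam {F ι : Type*} [Field F] [Fintype F] [Fintype ι] [DecidableEq ι] :
    Nat.card (Matrix ι ι F)ˣ = gam (Fintype.card F) (Fintype.card ι) := by
  rw [gam, Finset.prod_range, ← Matrix.card_GL_field]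
  exact Nat.card_congr
    (Units.mapEquiv (Matrix.reindexAlgEquiv F F (Fintype.equivFin ι)).toMulEquiv).toEquiv

/-- If an injective ring homomorphism has the centralizer of `s` as its image, it identifies the
units of its source with the stabilizer of `s` under conjugation. -/
theorem card_stabilizer_eq_card_units {R S : Type*} [Ring R] [Ring S] (f : R →+* S)
    (hf : Function.Injective f) (s : S) (hs : ∀ x, Commute x s ↔ x ∈ f.range) :
    Nat.card (MulAction.stabilizer (ConjAct Sˣ) s) = Nat.card Rˣ := by
  have stab (u : ConjAct Sˣ) :
      u ∈ MulAction.stabilizer (ConjAct Sˣ) s ↔ Commute ((ConjAct.ofConjAct u : Sˣ) : S) s := by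
    rw [MulAction.mem_stabilizer_iff, ConjAct.units_smul_def, Units.mul_inv_eq_iff_eq_mul]
    rfl
  refine (Nat.card_congr (Equiv.ofBijective
    (fun u : Rˣ => (⟨ConjAct.toConjAct (Units.map f.toMonoidHom u),
      (stab _).2 ((hs _).2 ⟨u, rfl⟩)⟩ : MulAction.stabilizer (ConjAct Sˣ) s)) ⟨?_, ?_⟩)).symm
  · intro u v h
    exact Units.ext (hf (congrArg
      (fun x : MulAction.stabilizer (ConjAct Sˣ) s => ((ConjAct.ofConjAct x.1 : Sˣ) : S)) h))
  · rintro ⟨u, hu⟩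
    have hc := (stab u).1 hu
    obtain ⟨x, hx⟩ := (hs _).1 hc
    obtain ⟨y, hy⟩ := (hs _).1 hc.units_inv_left
    refine ⟨⟨x, y, hf ?_, hf ?_⟩, ?_⟩
    · rw [map_mul, hx, hy, Units.mul_inv, map_one]
    · rw [map_mul, hx, hy, Units.inv_mul, map_one]
    · exact Subtype.ext (Units.ext hx)

theorem exists_perm_comp_eq {F ι : Type*} [DecidableEq F] [Fintype ι] (d e : ι → F)
    (h : ∀ a, Fintype.card {i // d i = a} = Fintype.card {i // e i = a}) :
    ∃ σ : Equiv.Perm ι, d ∘ σ = e := by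
  refine ⟨(Equiv.sigmaFiberEquiv e).symm.trans ((Equiv.sigmaCongrRight fun a =>
    Fintype.equivOfCardEq (h a).symm).trans (Equiv.sigmaFiberEquiv d)), ?_⟩
  funext i
  exact (Fintype.equivOfCardEq (h (e i)).symm ⟨i, rfl⟩).2

theorem exists_card_fiber_eq {F ι : Type*} [Fintype F] [DecidableEq F] [Fintype ι]
    (m : F → ℕ) (hm : ∑ a, m a = Fintype.card ι) :
    ∃ d : ι → F, ∀ a, Fintype.card {i // d i = a} = m a := by
  have e : ι ≃ Σ a, Fin (m a) := Fintype.equivOfCardEq (by simp [hm])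
  refine ⟨fun i => (e i).1, fun a => ?_⟩
  rw [Fintype.card_congr ((e.subtypeEquivOfSubtype (p := fun x => x.1 = a)).trans
    (Equiv.sigmaSubtype a)), Fintype.card_fin]

theorem diagonalizable_iff_exists_mem_orbit {F ι : Type*} [Field F] [Fintype ι] [DecidableEq ι]
    (A : Matrix ι ι F) :
    (∃ P : Matrix ι ι F, IsUnit P ∧ ∃ d : ι → F, P⁻¹ * A * P = Matrix.diagonal d) ↔
      ∃ d : ι → F, A ∈ MulAction.orbit (ConjAct (Matrix ι ι F)ˣ) (Matrix.diagonal d) := by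
  constructor
  · rintro ⟨_, ⟨u, rfl⟩, d, h⟩
    refine ⟨d, ConjAct.toConjAct u, ?_⟩
    simp only [ConjAct.units_smul_def, ConjAct.ofConjAct_toConjAct, ← h,
      ← Matrix.coe_units_inv]
    simp [mul_assoc]
  · rintro ⟨d, u, rfl⟩
    refine ⟨_, (ConjAct.ofConjAct u).isUnit, d, ?_⟩
    simp only [ConjAct.units_smul_def, ← Matrix.coe_units_inv]
    simp [mul_assoc]

theorem diagonal_comp_mem_orbit {F ι : Type*} [Field F] [Fintype ι] [DecidableEq ι]
    (d : ι → F) (σ : Equiv.Perm ι) :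
    Matrix.diagonal (d ∘ σ) ∈ MulAction.orbit (ConjAct (Matrix ι ι F)ˣ) (Matrix.diagonal d) := by
  have inv (τ : Equiv.Perm ι) :
      (1 : Matrix ι ι F).submatrix τ id * (1 : Matrix ι ι F).submatrix id τ = 1 := by
    rw [← Matrix.submatrix_mul _ _ _ _ _ Function.bijective_id, one_mul,
      Matrix.submatrix_one_equiv]
  let u : (Matrix ι ι F)ˣ := ⟨(1 : Matrix ι ι F).submatrix σ id,
    (1 : Matrix ι ι F).submatrix id σ, inv σ, mul_eq_one_comm.1 (inv σ)⟩
  refine ⟨ConjAct.toConjAct u, ?_⟩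
  change (1 : Matrix ι ι F).submatrix σ id * Matrix.diagonal d
    * (1 : Matrix ι ι F).submatrix id σ = _
  rw [← Matrix.submatrix_diagonal_equiv]
  ext i j
  simp +contextual [Matrix.mul_apply, Matrix.one_apply, Matrix.diagonal_apply]

theorem count_roots_charpoly_of_mem_orbit {F ι : Type*} [Field F] [DecidableEq F] [Fintype ι]
    [DecidableEq ι] (d : ι → F) {A : Matrix ι ι F}
    (hA : A ∈ MulAction.orbit (ConjAct (Matrix ι ι F)ˣ) (Matrix.diagonal d)) (a : F) :
    A.charpoly.roots.count a = Fintype.card {i // d i = a} := by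
  obtain ⟨u, rfl⟩ := hA
  have hchar : (u • Matrix.diagonal d).charpoly = ∏ i, (Polynomial.X - Polynomial.C (d i)) := by
    rw [ConjAct.units_smul_def, Matrix.coe_units_inv, ← Matrix.charpoly_diagonal,
      Matrix.charpoly_units_conj]
  have hroots : (∏ i, (Polynomial.X - Polynomial.C (d i))).roots = Finset.univ.val.map d := by
    rw [← Polynomial.roots_multiset_prod_X_sub_C (Finset.univ.val.map d), Multiset.map_map]
    rfl
  rw [hchar, hroots, Multiset.count_map, Fintype.card_subtype, Finset.card_def, Finset.filter_val]
  simp only [eq_comm]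

section Diagonal

variable {F ι : Type*} [Field F] [Fintype F] [DecidableEq F] [Fintype ι] [DecidableEq ι]

/-- Block diagonal matrices whose blocks are indexed by the fibres of `d`, as matrices indexed by
the source of `d`. -/
noncomputable def fiberBlockRingHom (d : ι → F) :
    (∀ a, Matrix {i // d i = a} {i // d i = a} F) →+* Matrix ι ι F :=
  (Matrix.reindexAlgEquiv F F (Equiv.sigmaFiberEquiv d)).toRingEquiv.toRingHom.comp
    (Matrix.blockDiagonal'RingHom (fun a => {i // d i = a}) F)

theorem fiberBlockRingHom_apply (d : ι → F)
    (M : ∀ a, Matrix {i // d i = a} {i // d i = a} F) (i j : ι) :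
    fiberBlockRingHom d M i j = if h : d j = d i then M (d i) ⟨i, rfl⟩ ⟨j, h⟩ else 0 := by
  change Matrix.blockDiagonal' M ⟨d i, ⟨i, rfl⟩⟩ ⟨d j, ⟨j, rfl⟩⟩ = _
  split_ifs with h
  · have key : ∀ (a : F) (ha : d j = a) (b : {i // d i = a}),
        Matrix.blockDiagonal' M ⟨a, b⟩ ⟨d j, ⟨j, rfl⟩⟩ = M a b ⟨j, ha⟩ := by
      rintro _ rfl b
      exact Matrix.blockDiagonal'_apply_eq M _ _ _
    exact key _ h _
  · exact Matrix.blockDiagonal'_apply_ne M _ _ (Ne.symm h)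

theorem fiberBlockRingHom_injective (d : ι → F) : Function.Injective (fiberBlockRingHom d) :=
  (Matrix.reindexAlgEquiv F F (Equiv.sigmaFiberEquiv d)).injective.comp
    Matrix.blockDiagonal'_injective

theorem commute_diagonal_iff_mem_range (d : ι → F) (x : Matrix ι ι F) :
    Commute x (Matrix.diagonal d) ↔ x ∈ (fiberBlockRingHom d).range := by
  have entries : Commute x (Matrix.diagonal d) ↔ ∀ i j, d j ≠ d i → x i j = 0 := by
    rw [commute_iff_eq, ← Matrix.ext_iff]
    refine forall₂_congr fun i j => ?_
    rw [Matrix.mul_diagonal, Matrix.diagonal_mul, mul_comm, mul_eq_mul_right_iff]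
    tauto
  rw [entries]
  constructor
  · intro h
    refine ⟨fun a => x.submatrix Subtype.val Subtype.val, ?_⟩
    ext i j
    rw [fiberBlockRingHom_apply]
    split_ifs with hij
    · rfl
    · exact (h i j hij).symm
  · rintro ⟨M, rfl⟩ i j hij
    rw [fiberBlockRingHom_apply, dif_neg hij]

theorem card_stabilizer_diagonal (d : ι → F) :
    Nat.card (MulAction.stabilizer (ConjAct (Matrix ι ι F)ˣ) (Matrix.diagonal d))
      = ∏ a, gam (Fintype.card F) (Fintype.card {i // d i = a}) := by
  rw [card_stabilizer_eq_card_units (fiberBlockRingHom d) (fiberBlockRingHom_injective d) _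
    (commute_diagonal_iff_mem_range d), Nat.card_congr MulEquiv.piUnits.toEquiv, Nat.card_pi]
  exact Finset.prod_congr rfl fun a _ => card_units_matrix_eq_gam

theorem card_orbit_diagonal_mul (d : ι → F) :
    Nat.card (MulAction.orbit (ConjAct (Matrix ι ι F)ˣ) (Matrix.diagonal d))
        * ∏ a, gam (Fintype.card F) (Fintype.card {i // d i = a})
      = gam (Fintype.card F) (Fintype.card ι) := by
  rw [← card_stabilizer_diagonal, ← Nat.card_prod,
    Nat.card_congr (MulAction.orbitProdStabilizerEquivGroup _ _), ← card_units_matrix_eq_gam]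
  rfl

end Diagonal

theorem gam_pos {q : ℕ} (hq : 1 < q) (n : ℕ) : 0 < gam q n :=
  Finset.prod_pos fun _ hi =>
    Nat.sub_pos_of_lt (Nat.pow_lt_pow_right hq (Finset.mem_range.1 hi))

theorem diagCount_eq_sum {F : Type} [Field F] [Fintype F] [DecidableEq F] (q : ℕ)
    (hq : Fintype.card F = q) (n : ℕ) :
    (diagCount F n : ℚ)
      = ∑ m ∈ (Fintype.piFinset fun _ : F => Finset.range (n + 1)).filter
            (fun m => ∑ a : F, m a = n),
          (gam q n : ℚ) / ∏ a : F, (gam q (m a) : ℚ) := by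
  classical
  subst hq
  simp only [diagCount, diagonalizable_iff_exists_mem_orbit]
  rw [Nat.card_eq_fintype_card, Fintype.card_subtype,
    Finset.card_eq_sum_card_fiberwise (f := fun A a => A.charpoly.roots.count a)
      (t := (Fintype.piFinset fun _ : F => Finset.range (n + 1)).filter
            (fun m => ∑ a : F, m a = n))]
  · rw [Nat.cast_sum]
    refine Finset.sum_congr rfl fun m hm => ?_
    obtain ⟨d, hd⟩ := exists_card_fiber_eq (ι := Fin n) m
      (by rw [(Finset.mem_filter.1 hm).2, Fintype.card_fin])
    have hprod : ∏ a, (gam (Fintype.card F) (m a) : ℚ) ≠ 0 :=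
      Finset.prod_ne_zero_iff.2 fun a _ =>
        Nat.cast_ne_zero.2 (gam_pos Fintype.one_lt_card _).ne'
    have horb := card_orbit_diagonal_mul d
    simp only [hd, Fintype.card_fin] at horb
    rw [eq_div_iff hprod, ← horb, Nat.cast_mul, Nat.cast_prod]
    congr 2
    rw [Nat.card_eq_card_toFinset]
    congr 1
    ext A
    simp only [Finset.mem_filter, Finset.mem_univ, true_and, Set.mem_toFinset]
    constructor
    · rintro ⟨⟨e, he⟩, rfl⟩
      obtain ⟨σ, rfl⟩ := exists_perm_comp_eq d e fun a =>
        (hd a).trans (count_roots_charpoly_of_mem_orbit e he a)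
      rwa [← MulAction.orbit_eq_iff.2 (diagonal_comp_mem_orbit d σ)]
    · intro hA
      exact ⟨⟨d, hA⟩, funext fun a => by rw [count_roots_charpoly_of_mem_orbit d hA, hd]⟩
  · intro A hA
    obtain ⟨d, hd⟩ := (Finset.mem_filter.1 hA).2
    have hsum : ∑ a, Fintype.card {i // d i = a} = n := by
      rw [← Fintype.card_sigma, Fintype.card_congr (Equiv.sigmaFiberEquiv d), Fintype.card_fin]
    simp only [Finset.coe_filter, Set.mem_ofPred_eq, Fintype.mem_piFinset, Finset.mem_range,
      count_roots_charpoly_of_mem_orbit d hd, hsum, and_true]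
    intro a
    exact Nat.lt_succ_of_le ((Fintype.card_subtype_le _).trans_eq (Fintype.card_fin n))
end

section
/- Suppose q is a power of 2. Then the number of n×n matrices N over 𝔽_q satisfying N² = 0 equals Σ_{0 ≤ i ≤ n/2} γ_n/(q^{i(2n−3i)} · γ_i · γ_{n−2i}) (the same count as the number of solutions of A² = I, via the bijection A ↦ A + I). -/
open Module in
theorem linearIndependent_dual_iff_surjective_pi {K V ι : Type*} [Field K] [AddCommGroup V]
    [Module K V] [Finite ι] (c : ι → Dual K V) :
    LinearIndependent K c ↔ Function.Surjective (LinearMap.pi c) := by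
  have := Fintype.ofFinite ι
  classical
  rw [← LinearMap.dualMap_injective_iff, ← LinearMap.ker_eq_bot, LinearMap.ker_eq_bot',
    Fintype.linearIndependent_iff]
  constructor
  · intro h φ hφ
    have key : ∑ j, φ (Pi.single j 1) • c j = 0 := by
      ext v
      have := LinearMap.congr_fun hφ v
      rw [LinearMap.dualMap_apply, LinearMap.zero_apply,
        LinearMap.pi_apply_eq_sum_univ φ (LinearMap.pi c v)] at this
      have hsingle (i : ι) : (fun j ↦ if i = j then (1 : K) else 0) = Pi.single i 1 := by
        ext j
        simp [Pi.single_apply, eq_comm]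
      simpa [mul_comm, hsingle] using this
    refine LinearMap.pi_ext' fun j ↦ LinearMap.ext_ring ?_
    simpa using h _ key j
  · intro h g hg j
    have := h (Fintype.linearCombination K g) (by
      ext v
      have := LinearMap.congr_fun hg v
      simpa [Fintype.linearCombination_apply, mul_comm] using this)
    simpa [Fintype.linearCombination_apply_single] using
      LinearMap.congr_fun this (Pi.single j 1)

theorem linearIndependent_dualAnnihilator_iff_surjective_pi {K V ι : Type*} [Field K]
    [AddCommGroup V] [Module K V] [Finite ι] {W : Submodule K V} (c : ι → W.dualAnnihilator) :
    LinearIndependent K c ↔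
      Function.Surjective (LinearMap.pi fun j ↦ (c j : Module.Dual K V)) := by
  rw [← linearIndependent_dual_iff_surjective_pi]
  exact (LinearMap.linearIndependent_iff_of_injOn W.dualAnnihilator.subtype
    Subtype.val_injective.injOn).symm

/-- Square-zero endomorphisms with range spanned by a given linearly independent family `b`
correspond to linearly independent families of functionals vanishing on `b`. -/
theorem card_squareZero_range_eq_span {K V ι : Type*} [Field K] [AddCommGroup V] [Module K V]
    [Fintype ι] {b : ι → V} (hb : LinearIndependent K b) :
    Nat.card {N : V →ₗ[K] V // N ∘ₗ N = 0 ∧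
        LinearMap.range N = Submodule.span K (Set.range b)} =
      Nat.card {c : ι → (Submodule.span K (Set.range b)).dualAnnihilator //
        LinearIndependent K c} := by
  set W := Submodule.span K (Set.range b)
  let B := Fintype.linearCombination K b
  have hB : Function.Injective B := by
    rw [← LinearMap.ker_eq_bot, LinearMap.ker_eq_bot']
    intro g hg
    ext j
    exact Fintype.linearIndependent_iff.1 hb g
      (by simpa [B, Fintype.linearCombination_apply] using hg) j
  have hBW : LinearMap.range B = W := Fintype.range_linearCombination K b
  have hli (c : ι → W.dualAnnihilator) := linearIndependent_dualAnnihilator_iff_surjective_pi c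
  symm
  refine Nat.card_congr (Equiv.ofBijective (fun c ↦
    ⟨B ∘ₗ LinearMap.pi fun j ↦ (c.1 j : Module.Dual K V), ?_, ?_⟩) ⟨?_, ?_⟩)
  · ext v
    have : (LinearMap.pi fun j ↦ (c.1 j : Module.Dual K V))
        (B (LinearMap.pi (fun j ↦ (c.1 j : Module.Dual K V)) v)) = 0 := by
      ext j
      exact (Submodule.mem_dualAnnihilator _).1 (c.1 j).2 _ (hBW.le (LinearMap.mem_range_self B _))
    simp only [LinearMap.comp_apply, this, map_zero, LinearMap.zero_apply]
  · rw [LinearMap.range_comp, LinearMap.range_eq_top.2 ((hli _).1 c.2), Submodule.map_top, hBW]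
  · intro c c' h
    ext j v
    have h1 := LinearMap.congr_fun (congrArg Subtype.val h) v
    exact congrFun (hB h1) j
  · rintro ⟨N, hN, hNW⟩
    let e := LinearEquiv.ofInjective B hB
    let L : V →ₗ[K] (ι → K) := e.symm.toLinearMap ∘ₗ
      N.codRestrict (LinearMap.range B) fun v ↦ by
        rw [hBW, ← hNW]; exact LinearMap.mem_range_self N v
    have hL (v : V) : B (L v) = N v :=
      congrArg Subtype.val (e.apply_symm_apply ⟨N v, _⟩)
    have hann (j : ι) : LinearMap.proj j ∘ₗ L ∈ W.dualAnnihilator := by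
      rw [Submodule.mem_dualAnnihilator]
      intro w hw
      rw [← hNW] at hw
      obtain ⟨v, rfl⟩ := hw
      have : L (N v) = 0 := hB (by rw [hL, map_zero]; exact LinearMap.congr_fun hN v)
      simp [this]
    refine ⟨⟨fun j ↦ ⟨_, hann j⟩, (hli _).2 ?_⟩, ?_⟩
    · intro g
      have : B g ∈ LinearMap.range N := by
        rw [hNW, ← hBW]; exact LinearMap.mem_range_self B g
      obtain ⟨v, hv⟩ := this
      exact ⟨v, hB ((hL v).trans hv)⟩
    · ext v
      exact hL v

/-- Double counting of pairs of a square-zero endomorphism of rank `i` and a basis of its range. -/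
theorem card_squareZero_finrank_range_mul {K V : Type*} [Field K] [Fintype K] [AddCommGroup V]
    [Module K V] [Finite V] {i : ℕ} (hi : 2 * i ≤ Module.finrank K V) :
    Nat.card {N : V →ₗ[K] V // N ∘ₗ N = 0 ∧ Module.finrank K (LinearMap.range N) = i} *
        gam (Fintype.card K) i =
      (∏ j ∈ Finset.range i, (Fintype.card K ^ Module.finrank K V - Fintype.card K ^ j)) *
        ∏ j ∈ Finset.range i,
          (Fintype.card K ^ (Module.finrank K V - i) - Fintype.card K ^ j) := by
  classical
  have : Finite (V →ₗ[K] V) := DFunLike.finite _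
  have := Fintype.ofFinite V
  let S := {N : V →ₗ[K] V // N ∘ₗ N = 0 ∧ Module.finrank K (LinearMap.range N) = i}
  let T := {b : Fin i → V // LinearIndependent K b}
  have : Fintype S := Fintype.ofFinite _
  have : Fintype T := Fintype.ofFinite _
  let P := Σ N : S, {b : Fin i → LinearMap.range N.1 // LinearIndependent K b}
  let Q := Σ b : T, {N : V →ₗ[K] V // N ∘ₗ N = 0 ∧
    LinearMap.range N = Submodule.span K (Set.range b.1)}
  have hP : Nat.card P = Nat.card S * gam (Fintype.card K) i := by
    rw [Nat.card_sigma, Finset.sum_congr rfl fun N _ ↦ by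
      rw [card_linearIndependent (by rw [N.2.2]), N.2.2,
        Fin.prod_univ_eq_prod_range (fun j ↦ Fintype.card K ^ i - Fintype.card K ^ j)]]
    simp [gam]
  have hQ : Nat.card Q = Nat.card T * ∏ j ∈ Finset.range i,
      (Fintype.card K ^ (Module.finrank K V - i) - Fintype.card K ^ j) := by
    have hfin (b : T) : Module.finrank K
        (Submodule.span K (Set.range b.1)).dualAnnihilator = Module.finrank K V - i := by
      have := Subspace.finrank_add_finrank_dualAnnihilator_eq (Submodule.span K (Set.range b.1))
      rw [finrank_span_eq_card b.2, Fintype.card_fin] at this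
      omega
    have : Finite (Module.Dual K V) := DFunLike.finite _
    have hcard (b : T) := card_linearIndependent (K := K)
      (V := (Submodule.span K (Set.range b.1)).dualAnnihilator) (k := i) (by rw [hfin]; omega)
    rw [Nat.card_sigma, Finset.sum_congr rfl fun b _ ↦ by
      rw [card_squareZero_range_eq_span b.2, hcard b, hfin, Fin.prod_univ_eq_prod_range
          (fun j ↦ Fintype.card K ^ (Module.finrank K V - i) - Fintype.card K ^ j)]]
    simp
  have hPQ : Nat.card P = Nat.card Q := by
    refine Nat.card_congr
      { toFun := fun p ↦ ⟨⟨fun j ↦ p.2.1 j, ?_⟩, p.1.1, p.1.2.1, ?_⟩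
        invFun := fun p ↦ ⟨⟨p.2.1, p.2.2.1, ?_⟩, fun j ↦ ⟨p.1.1 j, ?_⟩, ?_⟩
        left_inv := fun _ ↦ rfl
        right_inv := fun _ ↦ rfl }
    · exact p.2.2.map' (LinearMap.range p.1.1).subtype (by simp)
    · symm
      apply Submodule.eq_of_le_of_finrank_eq
      · rw [Submodule.span_le]
        rintro _ ⟨j, rfl⟩
        exact (p.2.1 j).2
      · have h := finrank_span_eq_card
          (p.2.2.map' (LinearMap.range p.1.1).subtype (by simp))
        rw [Fintype.card_fin] at h
        exact h.trans p.1.2.2.symm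
    · rw [p.2.2.2, finrank_span_eq_card p.1.2, Fintype.card_fin]
    · rw [p.2.2.2]
      exact Submodule.subset_span ⟨j, rfl⟩
    · exact LinearIndependent.of_comp (LinearMap.range p.2.1).subtype p.1.2
  rw [← hP, hPQ, hQ, card_linearIndependent (by omega),
    Fin.prod_univ_eq_prod_range
      (fun j ↦ Fintype.card K ^ Module.finrank K V - Fintype.card K ^ j)]

theorem gam_add (q i k : ℕ) :
    gam q (i + k) =
      (∏ j ∈ Finset.range i, (q ^ (i + k) - q ^ j)) * (q ^ (i * k) * gam q k) := by
  rw [gam, Finset.prod_range_add, gam]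
  congr 1
  simp_rw [pow_add q i, ← Nat.mul_sub]
  rw [Finset.prod_mul_distrib, Finset.prod_const, Finset.card_range, pow_mul]

theorem two_mul_finrank_range_le_of_comp_self_eq_zero {K V : Type*} [Field K] [AddCommGroup V]
    [Module K V] [FiniteDimensional K V] {N : V →ₗ[K] V} (hN : N ∘ₗ N = 0) :
    2 * Module.finrank K (LinearMap.range N) ≤ Module.finrank K V := by
  have h := LinearMap.finrank_range_add_finrank_ker N
  have := Submodule.finrank_mono (LinearMap.range_le_ker_iff.2 hN)
  omega

theorem squareZeroCount_eq_sum_of_char_two {F : Type} [Field F] [Fintype F] (q : ℕ)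
    (hq : Fintype.card F = q) (h2 : ∃ m : ℕ, q = 2 ^ m) (n : ℕ) :
    (Nat.card {N : Matrix (Fin n) (Fin n) F // N ^ 2 = 0} : ℚ)
      = ∑ i ∈ Finset.range (n / 2 + 1),
          (gam q n : ℚ) / ((q : ℚ) ^ (i * (2 * n - 3 * i)) * (gam q i : ℚ) * (gam q (n - 2 * i) : ℚ)) := by
  classical
  have hq1 : 1 < q := hq ▸ Fintype.one_lt_card
  let V := Fin n → F
  have hV : Module.finrank F V = n := by simp [V]
  have : Finite (V →ₗ[F] V) := DFunLike.finite _
  have := Fintype.ofFinite (V →ₗ[F] V)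
  have hmat : Nat.card {N : Matrix (Fin n) (Fin n) F // N ^ 2 = 0} =
      Nat.card {N : V →ₗ[F] V // N ∘ₗ N = 0} := by
    refine Nat.card_congr (Matrix.toLin'.toEquiv.subtypeEquiv fun N ↦ ?_)
    change _ ↔ Matrix.toLin' N ∘ₗ Matrix.toLin' N = 0
    rw [← Matrix.toLin'_mul, ← pow_two, LinearEquiv.map_eq_zero_iff]
  have hsum : Nat.card {N : V →ₗ[F] V // N ∘ₗ N = 0} = ∑ i ∈ Finset.range (n / 2 + 1),
      Nat.card {N : V →ₗ[F] V // N ∘ₗ N = 0 ∧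
        Module.finrank F (LinearMap.range N) = i} := by
    simp only [Nat.card_eq_fintype_card, Fintype.card_subtype]
    rw [Finset.card_eq_sum_card_fiberwise (t := Finset.range (n / 2 + 1))
      (f := fun N : V →ₗ[F] V ↦ Module.finrank F (LinearMap.range N))]
    · simp only [Finset.filter_filter]
    · intro N hN
      have := two_mul_finrank_range_le_of_comp_self_eq_zero (Finset.mem_filter.1 hN).2
      rw [hV] at this
      simp only [Finset.coe_range, Set.mem_Iio]
      omega
  rw [hmat, hsum, Nat.cast_sum]
  refine Finset.sum_congr rfl fun i hi ↦ ?_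
  obtain ⟨k, rfl⟩ : ∃ k, n = i + (i + k) := ⟨n - 2 * i, by grind⟩
  have h := card_squareZero_finrank_range_mul (K := F) (V := V) (i := i) (by omega)
  rw [hV, hq, Nat.add_sub_cancel_left] at h
  have h1 := gam_add q i (i + k)
  rw [gam_add q i k] at h1
  have he : i * (2 * (i + (i + k)) - 3 * i) = i * (i + k) + i * k := by
    rw [← Nat.mul_add]; congr 1; omega
  have hk : i + (i + k) - 2 * i = k := by omega
  have hi0 := (gam_pos hq1 i).ne'
  have hk0 := (gam_pos hq1 k).ne'
  rw [he, hk, eq_div_iff (by positivity)]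
  norm_cast
  rw [h1, pow_add]
  linear_combination (q ^ (i * (i + k)) * q ^ (i * k) * gam q k) * h
end
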